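/- The set of homeomorphisms f ∈ Homeo_{0,λ}(T²) whose rotation set is stable (with respect to C⁰-small perturbations within Homeo_{0,λ}(T²)) is open and dense in Homeo_{0,λ}(T²) for the uniform C⁰ topology. -/

import Mathlib

noncomputable section

open Metric Set Filter Topology MeasureTheory Pointwise

/-- The plane `ℝ²` with the Euclidean metric. -/
abbrev R2 : Type := EuclideanSpace ℝ (Fin 2)

/-- The integer lattice `ℤ² ⊂ ℝ²`. -/
def intLattice : AddSubgroup R2 where
  carrier := {v : R2 | ∀ i, ∃ n : ℤ, v i = (n : ℝ)}
  add_mem' := by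
    intro a b ha hb i
    obtain ⟨m, hm⟩ := ha i
    obtain ⟨n, hn⟩ := hb i
    exact ⟨m + n, by push_cast; rw [← hm, ← hn]; rfl⟩
  zero_mem' := fun i => ⟨0, by simp⟩
  neg_mem' := by
    intro a ha i
    obtain ⟨m, hm⟩ := ha i
    exact ⟨-m, by push_cast; rw [← hm]; rfl⟩

/-- The torus `T² = ℝ²/ℤ²`, with the quotient (Euclidean) metric. -/
abbrev T2 : Type := R2 ⧸ intLattice

/-- The covering projection `π : ℝ² → T²`. -/
def pr : R2 → T2 := QuotientAddGroup.mk

instance : MeasurableSpace T2 := borel T2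
instance : BorelSpace T2 := ⟨rfl⟩

/-- A fundamental domain `[0,1)²` for the lattice action. -/
def fundDomain : Set R2 := {x : R2 | ∀ i, x i ∈ Set.Ico (0 : ℝ) 1}

/-- Lebesgue (Haar) probability measure on the torus `T²`. -/
def lebT2 : Measure T2 := Measure.map pr (volume.restrict fundDomain)

/-- `F : ℝ² → ℝ²` is a lift of `f : T² → T²` if `π ∘ F = f ∘ π` and
`F (x + w) = F x + w` for every lattice vector `w ∈ ℤ²`. -/
structure IsLift (f : T2 ≃ₜ T2) (F : R2 ≃ₜ R2) : Prop where
  proj : ∀ x : R2, pr (F x) = f (pr x)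
  equivariant : ∀ x : R2, ∀ w ∈ intLattice, F (x + w) = F x + w

/-- `Homeo₀(T²)`: homeomorphisms of the torus isotopic to the identity,
characterized as those admitting a lift commuting with integer translations. -/
def Homeo0 : Set (T2 ≃ₜ T2) := {f | ∃ F : R2 ≃ₜ R2, IsLift f F}

/-- `Homeo_{0,λ}(T²)`: elements of `Homeo₀(T²)` preserving Lebesgue measure. -/
def Homeo0Leb : Set (T2 ≃ₜ T2) :=
  {f | f ∈ Homeo0 ∧ MeasurePreserving f lebT2 lebT2}

/-- The uniform `C⁰` distance `d_{C⁰}(f,g) = sup_x d(f(x), g(x))` on torus maps. -/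
def dC0 (f g : T2 ≃ₜ T2) : ℝ := ⨆ x : T2, dist (f x) (g x)

/-- The uniform distance `sup_{x ∈ ℝ²} ‖F(x) − G(x)‖` between maps of the plane. -/
def supDist (F G : R2 → R2) : ℝ := ⨆ x : R2, dist (F x) (G x)

/-- The rotation set `ρ(F̃)` of a lift: all limits `(F̃^{n_k}(z_k) − z_k)/n_k`. -/
def rotSet (F : R2 ≃ₜ R2) : Set R2 :=
  {v | ∃ (z : ℕ → R2) (n : ℕ → ℕ), Tendsto n atTop atTop ∧
    Tendsto (fun k => (n k : ℝ)⁻¹ • ((⇑F)^[n k] (z k) - z k)) atTop (𝓝 v)}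

/-- The rotation set of `f`, with fixed lift `F`, is `δ`-upper-stable in `H`. -/
def UpperStable (H : Set (T2 ≃ₜ T2)) (F : R2 ≃ₜ R2) (δ : ℝ) : Prop :=
  ∀ g ∈ H, ∀ G : R2 ≃ₜ R2, IsLift g G → supDist (⇑F) (⇑G) < δ →
    rotSet G ⊆ rotSet F

/-- The rotation set of `f`, with fixed lift `F`, is `δ`-stable in `H`. -/
def StableRS (H : Set (T2 ≃ₜ T2)) (F : R2 ≃ₜ R2) (δ : ℝ) : Prop :=
  ∀ g ∈ H, ∀ G : R2 ≃ₜ R2, IsLift g G → supDist (⇑F) (⇑G) < δ →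
    rotSet G = rotSet F

/-- `f` has a stable rotation set in `H`. -/
def HasStableRotSet (H : Set (T2 ≃ₜ T2)) (f : T2 ≃ₜ T2) : Prop :=
  ∃ F : R2 ≃ₜ R2, IsLift f F ∧ ∃ δ > 0, StableRS H F δ

/-- `S` is open in `H` for the uniform `C⁰` topology. -/
def OpenIn (H S : Set (T2 ≃ₜ T2)) : Prop :=
  ∀ f ∈ S ∩ H, ∃ δ > 0, ∀ g ∈ H, dC0 f g < δ → g ∈ S

/-- `S` is dense in `H` for the uniform `C⁰` topology. -/
def DenseIn (H S : Set (T2 ≃ₜ T2)) : Prop :=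
  ∀ f ∈ H, ∀ ε > 0, ∃ g ∈ S ∩ H, dC0 f g < ε

/-- `(x_i)_{0 ≤ i ≤ n}` is a finite `ε`-pseudo-orbit of `F`. -/
def IsPseudoOrbitUpTo (F : R2 → R2) (ε : ℝ) (x : ℕ → R2) (n : ℕ) : Prop :=
  ∀ i < n, dist (F (x i)) (x (i + 1)) < ε

/-- `(x_i)_{i ∈ ℕ}` is an infinite `ε`-pseudo-orbit of `F`. -/
def IsPseudoOrbit (F : R2 → R2) (ε : ℝ) (x : ℕ → R2) : Prop :=
  ∀ i : ℕ, dist (F (x i)) (x (i + 1)) < ε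

/-- The `ε`-pseudo-rotation set `ρ_ε(F̃)`. -/
def pseudoRotSet (F : R2 → R2) (ε : ℝ) : Set R2 :=
  {v | ∃ (n : ℕ → ℕ) (x : ℕ → ℕ → R2), Tendsto n atTop atTop ∧
    (∀ k, IsPseudoOrbitUpTo F ε (x k) (n k)) ∧
    Tendsto (fun k => (n k : ℝ)⁻¹ • (x k (n k) - x k 0)) atTop (𝓝 v)}

/-- The oscillation `osc(f) = sup_{x,y} ‖(F(x) − x) − (F(y) − y)‖` of a lift. -/
def osc (F : R2 → R2) : ℝ := ⨆ p : R2 × R2, ‖(F p.1 - p.1) - (F p.2 - p.2)‖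

/-- `f` has the shadowing property. -/
def Shadowing (f : T2 ≃ₜ T2) : Prop :=
  ∀ ε > 0, ∃ δ > 0, ∀ x : ℕ → T2, (∀ i, dist (f (x i)) (x (i + 1)) < δ) →
    ∃ z : T2, ∀ i, dist ((⇑f)^[i] z) (x i) < ε

/-- `v ∈ ℚ² ⊂ ℝ²`. -/
def IsRationalPoint (v : R2) : Prop := ∀ i, ∃ q : ℚ, v i = (q : ℝ)


theorem convex_diff_countable {W s : Set R2} (hW : Convex ℝ W) (hWo : IsOpen W)
    (hs : s.Countable) : IsPreconnected (W \ s) := by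
  have h : 1 < Module.rank ℝ R2 := by
    rw [← Module.finrank_eq_rank, finrank_euclideanSpace]; norm_cast
  have key : ∀ a ∈ W \ s, ∀ b ∈ W \ s, JoinedIn (W \ s) a b := by
    intro a ha b hb
    rcases eq_or_ne a b with rfl | hab
    · exact JoinedIn.refl ha
    let c := (2 : ℝ)⁻¹ • (a + b)
    let x := (2 : ℝ)⁻¹ • (b - a)
    have Ia : c - x = a := by
      simp only [c, x]
      module
    have Ib : c + x = b := by
      simp only [c, x]
      module
    have hc : c ∈ W := by
      have := hW ha.1 hb.1 (by norm_num : (0:ℝ) ≤ 2⁻¹) (by norm_num : (0:ℝ) ≤ 2⁻¹) (by norm_num)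
      simpa [c, smul_add] using this
    have x_ne_zero : x ≠ 0 := by simpa [x] using sub_ne_zero.2 hab.symm
    obtain ⟨y, hy⟩ : ∃ y, LinearIndependent ℝ ![x, y] :=
      exists_linearIndependent_pair_of_one_lt_rank h x_ne_zero
    have A : Set.Countable {t : ℝ | (segment ℝ (c + x) (c + t • y) ∩ s).Nonempty} := by
      apply countable_ofPred_nonempty_of_disjoint _ (fun t ↦ inter_subset_right) hs
      intro t t' htt'
      apply disjoint_iff_inter_eq_empty.2
      have N : {c + x} ∩ s = ∅ := by
        simpa only [singleton_inter_eq_empty, mem_compl_iff, Ib] using hb.2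
      rw [inter_assoc, inter_comm s, inter_assoc, inter_self, ← inter_assoc, ← subset_empty_iff, ← N]
      apply inter_subset_inter_left
      apply Eq.subset
      apply segment_inter_eq_endpoint_of_linearIndependent_of_ne hy htt'.symm
    have B : Set.Countable {t : ℝ | (segment ℝ (c - x) (c + t • y) ∩ s).Nonempty} := by
      apply countable_ofPred_nonempty_of_disjoint _ (fun t ↦ inter_subset_right) hs
      intro t t' htt'
      apply disjoint_iff_inter_eq_empty.2
      have N : {c - x} ∩ s = ∅ := by
        simpa only [singleton_inter_eq_empty, mem_compl_iff, Ia] using ha.2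
      rw [inter_assoc, inter_comm s, inter_assoc, inter_self, ← inter_assoc, ← subset_empty_iff, ← N]
      apply inter_subset_inter_left
      rw [sub_eq_add_neg _ x]
      apply Eq.subset
      apply segment_inter_eq_endpoint_of_linearIndependent_of_ne _ htt'.symm
      convert! hy.units_smul ![-1, 1]
      simp [← List.ofFn_inj]
    have hopen : IsOpen {t : ℝ | c + t • y ∈ W} := hWo.preimage (by fun_prop)
    obtain ⟨t, htW, ht⟩ := ((A.union B).dense_compl ℝ).inter_open_nonempty _ hopen
      ⟨0, by simpa using hc⟩
    let z := c + t • y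
    have hz : z ∈ W := htW
    simp only [compl_union, mem_inter_iff, mem_compl_iff, mem_ofPred_eq, not_nonempty_iff_eq_empty]
      at ht
    have JA : JoinedIn (W \ s) a z := by
      apply JoinedIn.of_segment_subset
      intro u hu
      refine ⟨hW.segment_subset ha.1 hz hu, fun hus => ?_⟩
      have : u ∈ segment ℝ (c - x) (c + t • y) ∩ s := ⟨by rw [Ia]; exact hu, hus⟩
      rw [ht.2] at this; exact this
    have JB : JoinedIn (W \ s) b z := by
      apply JoinedIn.of_segment_subset
      intro u hu
      refine ⟨hW.segment_subset hb.1 hz hu, fun hus => ?_⟩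
      have : u ∈ segment ℝ (c + x) (c + t • y) ∩ s := ⟨by rw [Ib]; exact hu, hus⟩
      rw [ht.1] at this; exact this
    exact JA.trans JB.symm
  rcases (W \ s).eq_empty_or_nonempty with he | ⟨a, ha⟩
  · rw [he]; exact isPreconnected_empty
  · exact (IsPathConnected.isConnected ⟨a, ha, fun {b} hb => key a ha b hb⟩).isPreconnected

/-- Round twist of the complex plane. -/
def ctwist (ω : ℝ → ℝ) (hω : Continuous ω) : ℂ ≃ₜ ℂ where
  toFun z := Complex.exp (ω ‖z‖ * Complex.I) * z
  invFun z := Complex.exp (-(ω ‖z‖) * Complex.I) * z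
  left_inv z := by
    simp only [norm_mul, Complex.norm_exp_ofReal_mul_I, one_mul]
    rw [← mul_assoc, ← Complex.exp_add]; simp
  right_inv z := by
    have : ‖Complex.exp (-(ω ‖z‖) * Complex.I)‖ = 1 := by
      have := Complex.norm_exp_ofReal_mul_I (-(ω ‖z‖)); push_cast at this; exact this
    simp only [norm_mul, this, one_mul]
    rw [← mul_assoc, ← Complex.exp_add]; simp
  continuous_toFun := by fun_prop
  continuous_invFun := by fun_prop

theorem ctwist_mp (ω : ℝ → ℝ) (hω : Continuous ω) :
    MeasurePreserving (ctwist ω hω) volume volume := by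
  refine ⟨(ctwist ω hω).continuous.measurable, ?_⟩
  ext E hE
  rw [Measure.map_apply (ctwist ω hω).continuous.measurable hE]
  have hE' : MeasurableSet ((ctwist ω hω) ⁻¹' E) := (ctwist ω hω).continuous.measurable hE
  rw [← lintegral_indicator_one hE, ← lintegral_indicator_one hE',
    ← Complex.lintegral_comp_polarCoord_symm, ← Complex.lintegral_comp_polarCoord_symm]
  rw [polarCoord_target, Measure.volume_eq_prod]
  have hmeas : ∀ A : Set ℂ, MeasurableSet A → Measurable (fun p : ℝ × ℝ =>
      ENNReal.ofReal p.1 • A.indicator (1 : ℂ → ENNReal) (Complex.polarCoord.symm p)) := by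
    intro A hA
    have : Measurable (fun p : ℝ × ℝ => Complex.polarCoord.symm p) := by
      simp only [Complex.polarCoord_symm_apply]
      fun_prop
    have h2 : Measurable (A.indicator (1 : ℂ → ENNReal)) := measurable_one.indicator hA
    exact (by fun_prop : Measurable fun p : ℝ × ℝ => ENNReal.ofReal p.1).smul (h2.comp this)
  rw [← Measure.prod_restrict, lintegral_prod _ (hmeas _ hE').aemeasurable,
    lintegral_prod _ (hmeas _ hE).aemeasurable]
  refine setLIntegral_congr_fun measurableSet_Ioi (fun r hr => ?_)
  have hr : 0 < r := hr
  set h : ℝ → ENNReal := fun θ => ENNReal.ofReal r • E.indicator 1 (Complex.polarCoord.symm (r, θ)) with hh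
  have hper : ∀ θ (k : ℤ), h (θ + k * (2 * Real.pi)) = h θ := by
    intro θ k
    simp only [hh, Complex.polarCoord_symm_apply]
    simp
  have h1 : ∀ θ, ENNReal.ofReal r • ((ctwist ω hω) ⁻¹' E).indicator (1 : ℂ → ENNReal)
      (Complex.polarCoord.symm (r, θ)) = h (θ + ω r) := by
    intro θ
    have : ctwist ω hω (Complex.polarCoord.symm (r, θ)) = Complex.polarCoord.symm (r, θ + ω r) := by
      have hn : ‖Complex.polarCoord.symm (r, θ)‖ = r := by
        simp [abs_of_pos hr]
      change Complex.exp (ω ‖_‖ * Complex.I) * _ = _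
      rw [hn]
      simp only [Complex.polarCoord_symm_apply]
      have e1 := Complex.exp_mul_I (θ : ℂ)
      have e2 := Complex.exp_mul_I ((θ + ω r : ℝ) : ℂ)
      simp only [Complex.ofReal_cos, Complex.ofReal_sin]
      rw [← e1, ← e2, mul_left_comm, ← Complex.exp_add]
      push_cast; ring_nf
    simp only [hh, ← this]
    rfl
  simp_rw [h1]
  rw [setLIntegral_congr Ioo_ae_eq_Ioc, setLIntegral_congr (f := h) Ioo_ae_eq_Ioc]
  have hT : (0 : ℝ) < 2 * Real.pi := by positivity
  have d1 := isAddFundamentalDomain_Ioc hT (-Real.pi) volume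
  have d2 := isAddFundamentalDomain_Ioc hT (-Real.pi + ω r) volume
  have e := d1.setLIntegral_eq d2 h (by
    rintro ⟨g, hg⟩ x
    obtain ⟨k, rfl⟩ := AddSubgroup.mem_zmultiples_iff.1 hg
    change h (k • (2 * Real.pi) + x) = h x
    rw [add_comm, zsmul_eq_mul]; exact hper x k)
  rw [show -Real.pi + 2 * Real.pi = Real.pi by ring,
    show -Real.pi + ω r + 2 * Real.pi = Real.pi + ω r by ring] at e
  rw [e]
  have mp := measurePreserving_add_right (volume : Measure ℝ) (ω r)
  have := mp.setLIntegral_comp_preimage_emb (MeasurableEquiv.addRight (ω r)).measurableEmbedding h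
    (Ioc (-Real.pi + ω r) (Real.pi + ω r))
  rw [← this]
  simp


def qf (α : ℝ) (m x : R2) : ℝ := ((x 0 - m 0) / α) ^ 2 + (x 1 - m 1) ^ 2

def ellLin (α : ℝ) (hα : α ≠ 0) : ℂ ≃ₗ[ℝ] R2 where
  toFun z := !₂[α * z.re, z.im]
  invFun x := ⟨x 0 / α, x 1⟩
  left_inv z := by
    apply Complex.ext <;> simp; field_simp
  right_inv x := by
    ext i; fin_cases i <;> simp; field_simp
  map_add' z w := by ext i; fin_cases i <;> simp; ring
  map_smul' c z := by ext i; fin_cases i <;> simp; ring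

def ellCLE (α : ℝ) (hα : α ≠ 0) : ℂ ≃L[ℝ] R2 := (ellLin α hα).toContinuousLinearEquiv

theorem ellCLE_apply (α : ℝ) (hα : α ≠ 0) (z : ℂ) : ellCLE α hα z = !₂[α * z.re, z.im] := rfl
theorem ellCLE_symm_apply (α : ℝ) (hα : α ≠ 0) (x : R2) :
    (ellCLE α hα).symm x = ⟨x 0 / α, x 1⟩ := rfl

theorem conj_mp (A : ℂ ≃L[ℝ] R2) (T : ℂ ≃ₜ ℂ) (hT : MeasurePreserving T volume volume) :
    MeasurePreserving (fun x => A (T (A.symm x))) (volume : Measure R2) volume := by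
  have mA : Measurable A := A.continuous.measurable
  have mA' : Measurable A.symm := A.symm.continuous.measurable
  have mT : Measurable T := T.continuous.measurable
  refine ⟨mA.comp (mT.comp mA'), ?_⟩
  have h0 : (fun x => A (T (A.symm x))) = A ∘ T ∘ A.symm := rfl
  have : (Measure.map A.symm (volume : Measure R2)).IsAddHaarMeasure :=
    ContinuousLinearEquiv.isAddHaarMeasure_map A.symm volume
  obtain ⟨c, hc⟩ : ∃ c : ENNReal, Measure.map A.symm (volume : Measure R2) = c • volume :=
    ⟨_, Measure.isAddLeftInvariant_eq_smul _ _⟩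
  rw [h0, ← Measure.map_map mA (mT.comp mA'), ← Measure.map_map mT mA', hc, Measure.map_smul,
    hT.map_eq, ← hc, Measure.map_map mA mA']
  simp

theorem etwist_exists (α : ℝ) (hα : 0 < α) (m : R2) (ρ' ρ β : ℝ) (h0 : 0 ≤ ρ') (h1 : ρ' < ρ) :
    ∃ T : R2 ≃ₜ R2, MeasurePreserving T volume volume ∧
      (∀ x, ρ ^ 2 ≤ qf α m x → T x = x) ∧
      (∀ x, qf α m x ≤ ρ' ^ 2 →
        T x = !₂[m 0 + α * (Real.cos β * ((x 0 - m 0) / α) - Real.sin β * (x 1 - m 1)),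
          m 1 + (Real.sin β * ((x 0 - m 0) / α) + Real.cos β * (x 1 - m 1))]) ∧
      (∀ x, qf α m (T x) = qf α m x) := by
  have hα' : α ≠ 0 := hα.ne'
  let ω : ℝ → ℝ := fun r => β * max 0 (min 1 ((ρ - r) / (ρ - ρ')))
  have hω : Continuous ω := by fun_prop
  let A := ellCLE α hα'
  let T0 := ctwist ω hω
  let T : R2 ≃ₜ R2 := (Homeomorph.addRight (-m)).trans
    ((A.symm.toHomeomorph.trans (T0.trans A.toHomeomorph)).trans (Homeomorph.addRight m))
  have hT : ∀ x, T x = A (T0 (A.symm (x + -m))) + m := fun x => rfl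
  have hn : ∀ x : R2, ‖A.symm (x + -m)‖ ^ 2 = qf α m x := by
    intro x
    rw [← Complex.normSq_eq_norm_sq, ellCLE_symm_apply, Complex.normSq_apply, qf]
    simp; ring
  have hT0 : ∀ z, T0 z = Complex.exp (ω ‖z‖ * Complex.I) * z := fun z => rfl
  refine ⟨T, ?_, ?_, ?_, ?_⟩
  · have := ((measurePreserving_add_right (volume : Measure R2) m).comp
      ((conj_mp A T0 (ctwist_mp ω hω)).comp
        (measurePreserving_add_right (volume : Measure R2) (-m))))
    exact this
  · intro x hx
    rw [← hn, sq_le_sq₀ (by linarith) (norm_nonneg _)] at hx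
    have : ω ‖A.symm (x + -m)‖ = 0 := by
      have : (ρ - ‖A.symm (x + -m)‖) / (ρ - ρ') ≤ 0 :=
        div_nonpos_of_nonpos_of_nonneg (by linarith) (by linarith)
      simp only [ω]
      rw [max_eq_left ((min_le_right _ _).trans this), mul_zero]
    rw [hT, hT0, this]
    simp
  · intro x hx
    rw [← hn, sq_le_sq₀ (norm_nonneg _) h0] at hx
    have : ω ‖A.symm (x + -m)‖ = β := by
      have : 1 ≤ (ρ - ‖A.symm (x + -m)‖) / (ρ - ρ') := by
        rw [le_div_iff₀ (by linarith)]; linarith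
      simp only [ω]
      rw [min_eq_left this]; simp
    rw [hT, hT0, this, ellCLE_apply, ellCLE_symm_apply, Complex.exp_mul_I]
    rw [← Complex.ofReal_cos, ← Complex.ofReal_sin]
    ext i; fin_cases i <;> simp [sub_eq_add_neg, -Complex.ofReal_cos, -Complex.ofReal_sin] <;> ring
  · intro x
    rw [← hn, ← hn, hT]
    have : A (T0 (A.symm (x + -m))) + m + -m = A (T0 (A.symm (x + -m))) := by abel
    rw [this, ContinuousLinearEquiv.symm_apply_apply, hT0, norm_mul, Complex.norm_exp_ofReal_mul_I,
      one_mul]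

/-- Equivariant, measure preserving homeomorphisms of the plane. -/
def Eqv (F : R2 → R2) : Prop := ∀ x : R2, ∀ w ∈ intLattice, F (x + w) = F x + w

theorem Eqv.symm {F : R2 ≃ₜ R2} (h : Eqv F) : Eqv F.symm := by
  intro x w hw
  apply F.injective
  rw [h _ _ hw]; simp

def PP : Subgroup (R2 ≃ₜ R2) where
  carrier := {F | Eqv F ∧ MeasurePreserving F volume volume}
  mul_mem' {F G} hF hG := ⟨fun x w hw => by
    change F (G (x + w)) = F (G x) + w
    rw [hG.1 _ _ hw, hF.1 _ _ hw], hF.2.comp hG.2⟩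
  one_mem' := ⟨fun x w hw => rfl, MeasurePreserving.id _⟩
  inv_mem' {F} hF := ⟨hF.1.symm, MeasurePreserving.symm F.toMeasurableEquiv hF.2⟩

def flr (x : R2) : R2 := !₂[(⌊x 0⌋ : ℝ), (⌊x 1⌋ : ℝ)]
def frc (x : R2) : R2 := !₂[Int.fract (x 0), Int.fract (x 1)]

theorem frc_add_flr (x : R2) : frc x + flr x = x := by
  ext i; fin_cases i <;> simp [frc, flr, Int.fract_add_floor]

theorem flr_mem (x : R2) : flr x ∈ intLattice := by
  intro i; fin_cases i
  · exact ⟨⌊x 0⌋, rfl⟩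
  · exact ⟨⌊x 1⌋, rfl⟩

theorem frc_mem (x : R2) : frc x ∈ fundDomain := by
  intro i; fin_cases i
  · exact ⟨Int.fract_nonneg _, Int.fract_lt_one _⟩
  · exact ⟨Int.fract_nonneg _, Int.fract_lt_one _⟩

theorem flr_add (x w : R2) (hw : w ∈ intLattice) : flr (x + w) = flr x + w := by
  obtain ⟨a, ha⟩ := hw 0
  obtain ⟨b, hb⟩ := hw 1
  ext i; fin_cases i <;> simp [flr, ha, hb]

theorem frc_add (x w : R2) (hw : w ∈ intLattice) : frc (x + w) = frc x := by
  have h1 := frc_add_flr (x + w)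
  rw [flr_add x w hw] at h1
  have h2 := frc_add_flr x
  have : frc (x + w) + (flr x + w) = frc x + (flr x + w) := by
    rw [h1, ← add_assoc, h2]
  exact add_right_cancel this

theorem frc_of_mem {x : R2} (hx : x ∈ fundDomain) : frc x = x := by
  ext i; fin_cases i
  · exact Int.fract_eq_self.2 (hx 0)
  · exact Int.fract_eq_self.2 (hx 1)

theorem flr_of_mem {x : R2} (hx : x ∈ fundDomain) : flr x = 0 := by
  have := frc_add_flr x
  rw [frc_of_mem hx] at this
  simpa using this

theorem fund_unique {x w : R2} (hw : w ∈ intLattice) (hx : x ∈ fundDomain)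
    (hxw : x + w ∈ fundDomain) : w = 0 := by
  have h := flr_add x w hw
  rw [flr_of_mem hx, flr_of_mem hxw] at h
  simpa using h.symm

theorem measurable_fund : MeasurableSet fundDomain := by
  have : fundDomain = ⋂ i, (fun x : R2 => x i) ⁻¹' (Set.Ico (0 : ℝ) 1) := by
    ext x; simp [fundDomain]
  rw [this]
  exact MeasurableSet.iInter fun i =>
    (by fun_prop : Continuous fun x : R2 => x i).measurable measurableSet_Ico

instance : Countable intLattice := by
  let f : ℤ × ℤ → intLattice := fun p => ⟨!₂[(p.1 : ℝ), (p.2 : ℝ)], by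
    intro i; fin_cases i
    · exact ⟨p.1, rfl⟩
    · exact ⟨p.2, rfl⟩⟩
  have : Function.Surjective f := by
    rintro ⟨w, hw⟩
    obtain ⟨a, ha⟩ := hw 0
    obtain ⟨b, hb⟩ := hw 1
    refine ⟨(a, b), Subtype.ext ?_⟩
    ext i; fin_cases i
    · exact ha.symm
    · exact hb.symm
  exact this.countable

theorem fund_isFD : IsAddFundamentalDomain intLattice fundDomain (volume : Measure R2) := by
  refine IsAddFundamentalDomain.mk' measurable_fund.nullMeasurableSet fun x => ?_
  refine ⟨⟨-flr x, neg_mem (flr_mem x)⟩, ?_, ?_⟩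
  · have := frc_add_flr x
    have h2 : -flr x + x = frc x := by
      calc -flr x + x = -flr x + (frc x + flr x) := by rw [this]
        _ = frc x := by abel
    change -flr x + x ∈ fundDomain
    rw [h2]; exact frc_mem x
  · rintro ⟨w, hw⟩ h
    have h : w + x ∈ fundDomain := h
    have := flr_add x w hw
    rw [add_comm x, flr_of_mem h] at this
    exact Subtype.ext (by simpa [eq_neg_iff_add_eq_zero, add_comm] using this.symm)


def oUnit : Set R2 := {x | ∀ i, x i ∈ Set.Ioo (0 : ℝ) 1}

theorem oUnit_sub : oUnit ⊆ fundDomain := fun _ hx i => ⟨(hx i).1.le, (hx i).2⟩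

def extFun (φ : R2 → R2) (x : R2) : R2 := φ (frc x) + flr x

theorem extFun_cont (φ : R2 → R2) (hc : Continuous φ) (hfix : ∀ x, x ∉ oUnit → φ x = x) :
    Continuous (extFun φ) := by
  have h1 : extFun φ = fun x => x + (φ (frc x) - frc x) := by
    ext1 x
    have := frc_add_flr x
    calc φ (frc x) + flr x = frc x + flr x + (φ (frc x) - frc x) := by abel
      _ = _ := by rw [this]
  rw [h1]
  refine continuous_id.add ?_
  let D : ℝ → ℝ → R2 := fun a b => φ !₂[a, b] - !₂[a, b]
  have hDc : Continuous (Function.uncurry D) := by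
    simp only [D, Function.uncurry_def]; fun_prop
  have hD0 : ∀ a b, (a ≤ 0 ∨ 1 ≤ a ∨ b ≤ 0 ∨ 1 ≤ b) → D a b = 0 := by
    intro a b h
    simp only [D]
    rw [hfix, sub_self]
    intro hm
    have h0 := hm 0
    have h1 := hm 1
    simp at h0 h1
    rcases h with h | h | h | h <;> linarith [h0.1, h0.2, h1.1, h1.2]
  have e1 : Continuous (fun p : ℝ × ℝ => D p.1 (Int.fract p.2)) := by
    refine ContinuousOn.comp_fract (s := fun p : ℝ × ℝ => p.2) (f := fun p b => D p.1 b) ?_ ?_ ?_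
    · have : Continuous (fun q : (ℝ × ℝ) × ℝ => Function.uncurry D (q.1.1, q.2)) := by fun_prop
      exact this.continuousOn
    · fun_prop
    · intro s; rw [hD0 _ _ (by simp), hD0 _ _ (by simp)]
  have e2 : Continuous (fun p : ℝ × ℝ => D (Int.fract p.1) (Int.fract p.2)) := by
    refine ContinuousOn.comp_fract (s := fun p : ℝ × ℝ => p.1)
      (f := fun p a => D a (Int.fract p.2)) ?_ ?_ ?_
    · have : Continuous (fun q : (ℝ × ℝ) × ℝ => (fun p : ℝ × ℝ => D p.1 (Int.fract p.2)) (q.2, q.1.2)) :=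
        e1.comp (by fun_prop)
      exact this.continuousOn
    · fun_prop
    · intro s; rw [hD0 _ _ (by simp), hD0 _ _ (by simp)]
  exact e2.comp (by fun_prop : Continuous fun x : R2 => (x 0, x 1))

theorem fix_maps_fund (φ : R2 → R2) (hi : Function.Injective φ) (hfix : ∀ x, x ∉ oUnit → φ x = x)
    {x : R2} (hx : x ∈ fundDomain) : φ x ∈ fundDomain := by
  by_cases h : x ∈ oUnit
  · by_contra hcon
    have h2 : φ x ∉ oUnit := fun h' => hcon (oUnit_sub h')
    have h3 := hi (hfix _ h2)
    rw [h3] at h2; exact h2 h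
  · rw [hfix x h]; exact hx

theorem extFun_comp (φ χ : R2 → R2) (hi : Function.Injective φ)
    (hfix : ∀ x, x ∉ oUnit → φ x = x) (x : R2) :
    extFun χ (extFun φ x) = extFun (χ ∘ φ) x := by
  simp only [extFun, Function.comp]
  rw [frc_add _ _ (flr_mem x), flr_add _ _ (flr_mem x),
    frc_of_mem (fix_maps_fund φ hi hfix (frc_mem x)),
    flr_of_mem (fix_maps_fund φ hi hfix (frc_mem x)), zero_add]

theorem ext_exists (φ : R2 ≃ₜ R2) (hmp : MeasurePreserving φ volume volume)
    (hfix : ∀ x, x ∉ oUnit → φ x = x) :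
    ∃ Φ ∈ PP, ∀ x, Φ x = φ (frc x) + flr x := by
  have hfix' : ∀ x, x ∉ oUnit → φ.symm x = x := fun x hx => by
    rw [Homeomorph.symm_apply_eq, hfix x hx]
  let Φ : R2 ≃ₜ R2 :=
    { toFun := extFun φ
      invFun := extFun φ.symm
      left_inv := fun x => by
        rw [extFun_comp _ _ φ.injective hfix]; simp [extFun, frc_add_flr]
      right_inv := fun x => by
        rw [extFun_comp _ _ φ.symm.injective hfix']; simp [extFun, frc_add_flr]
      continuous_toFun := extFun_cont _ φ.continuous hfix
      continuous_invFun := extFun_cont _ φ.symm.continuous hfix' }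
  have hΦ : ∀ x, Φ x = φ (frc x) + flr x := fun x => rfl
  have heq : Eqv Φ := by
    intro x w hw
    rw [hΦ, hΦ, frc_add _ _ hw, flr_add _ _ hw, add_assoc]
  refine ⟨Φ, ⟨heq, ?_⟩, hΦ⟩
  have mΦ : Measurable Φ := Φ.continuous.measurable
  refine ⟨mΦ, ?_⟩
  ext E hE
  rw [Measure.map_apply mΦ hE, fund_isFD.measure_eq_tsum, fund_isFD.measure_eq_tsum E]
  refine tsum_congr fun w => ?_
  have hφf : φ ⁻¹' fundDomain = fundDomain := by
    ext x
    refine ⟨fun h => ?_, fun h => fix_maps_fund φ φ.injective hfix h⟩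
    have := fix_maps_fund φ.symm φ.symm.injective hfix' h
    simpa using this
  have : ((w +ᵥ Φ ⁻¹' E) ∩ fundDomain) = φ ⁻¹' ((w +ᵥ E) ∩ fundDomain) := by
    rw [preimage_inter, hφf]
    ext x
    simp only [mem_inter_iff, and_congr_left_iff]
    intro hx
    rw [mem_vadd_set_iff_neg_vadd_mem, mem_preimage, mem_preimage, mem_vadd_set_iff_neg_vadd_mem]
    have e1 : (-w +ᵥ x : R2) = x + -(w : R2) := add_comm _ _
    have e2 : (-w +ᵥ φ x : R2) = φ x + -(w : R2) := add_comm _ _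
    rw [e1, e2, heq _ _ (neg_mem w.2), hΦ, frc_of_mem hx, flr_of_mem hx, add_zero]
  rw [this, hmp.measure_preimage]
  exact ((hE.const_vadd w).inter measurable_fund).nullMeasurableSet

theorem PP_trans (v : R2) : Homeomorph.addRight v ∈ PP :=
  ⟨fun x w _ => by simp only [Homeomorph.coe_addRight]; abel,
    measurePreserving_add_right volume v⟩

theorem qf_shift (α : ℝ) (m x v : R2) : qf α m (x + v) = qf α (m - v) x := by
  simp [qf]; ring

theorem ptwist_exists (α : ℝ) (hα : 0 < α) (hα1 : α ≤ 1) (m : R2) (ρ' ρ β : ℝ) (h0 : 0 ≤ ρ')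
    (h1 : ρ' < ρ) (h2 : ρ ≤ 1 / 2) :
    ∃ T ∈ PP,
      (∀ x, (∀ w ∈ intLattice, ρ ^ 2 ≤ qf α m (x + w)) → T x = x) ∧
      (∀ x, qf α m x ≤ ρ' ^ 2 →
        T x = !₂[m 0 + α * (Real.cos β * ((x 0 - m 0) / α) - Real.sin β * (x 1 - m 1)),
          m 1 + (Real.sin β * ((x 0 - m 0) / α) + Real.cos β * (x 1 - m 1))]) ∧
      (∀ x, qf α m x < ρ ^ 2 → qf α m (T x) < ρ ^ 2) := by
  let c : R2 := !₂[1 / 2, 1 / 2]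
  obtain ⟨φ, hmp, hA, hB, hC⟩ := etwist_exists α hα c ρ' ρ β h0 h1
  have hin : ∀ x, qf α c x < ρ ^ 2 → x ∈ oUnit := by
    intro x hx
    have e0 : (x 0 - 1 / 2) ^ 2 ≤ ((x 0 - 1 / 2) / α) ^ 2 := by
      rw [div_pow, le_div_iff₀ (by positivity)]
      have : α ^ 2 ≤ 1 := by nlinarith
      nlinarith [sq_nonneg (x 0 - 1 / 2)]
    have e1 : ((x 0 - 1 / 2) / α) ^ 2 + (x 1 - 1 / 2) ^ 2 < ρ ^ 2 := by simpa [qf, c] using hx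
    have hρ : ρ ^ 2 ≤ (1 / 2) ^ 2 := pow_le_pow_left₀ (by linarith) h2 2
    have a0 : |x 0 - 1 / 2| < 1 / 2 := abs_lt_of_sq_lt_sq
      (by nlinarith [sq_nonneg (x 1 - 1 / 2)]) (by norm_num)
    have a1 : |x 1 - 1 / 2| < 1 / 2 := abs_lt_of_sq_lt_sq
      (by nlinarith [sq_nonneg ((x 0 - 1 / 2) / α)]) (by norm_num)
    rw [abs_lt] at a0 a1
    intro i; fin_cases i
    · exact ⟨by simp; linarith, by simp; linarith⟩
    · exact ⟨by simp; linarith, by simp; linarith⟩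
  have hfix : ∀ x, x ∉ oUnit → φ x = x := fun x hx => hA x (le_of_not_gt fun h => hx (hin x h))
  obtain ⟨Φ, hΦ, hΦe⟩ := ext_exists φ hmp hfix
  let v : R2 := m - c
  have hT' : ∀ x, (Homeomorph.addRight v * Φ * Homeomorph.addRight (-v)) x = Φ (x + -v) + v :=
    fun x => rfl
  have hq : ∀ x, qf α c (x + -v) = qf α m x := by
    intro x; rw [qf_shift]; congr 1; simp [v]
  have hin2 : ∀ x, qf α m x < ρ ^ 2 → Φ (x + -v) = φ (x + -v) := by
    intro x hx
    rw [← hq] at hx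
    rw [hΦe, frc_of_mem (oUnit_sub (hin _ hx)), flr_of_mem (oUnit_sub (hin _ hx)), add_zero]
  have hlt : ρ' ^ 2 < ρ ^ 2 := pow_lt_pow_left₀ h1 h0 (by norm_num)
  refine ⟨Homeomorph.addRight v * Φ * Homeomorph.addRight (-v),
    mul_mem (mul_mem (PP_trans _) hΦ) (PP_trans _), ?_, ?_, ?_⟩
  · intro x hx
    rw [hT', hΦe]
    have h3 := hx (-flr (x + -v)) (neg_mem (flr_mem _))
    have h4 : x + -flr (x + -v) + -v = frc (x + -v) := by
      have := frc_add_flr (x + -v)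
      calc x + -flr (x + -v) + -v = (x + -v) + -flr (x + -v) := by abel
        _ = (frc (x + -v) + flr (x + -v)) + -flr (x + -v) := by rw [this]
        _ = _ := by abel
    rw [← hq, h4] at h3
    rw [hA _ h3, frc_add_flr]; abel
  · intro x hx
    rw [hT', hin2 x (hx.trans_lt hlt), hB _ (by rw [hq]; exact hx)]
    ext i; fin_cases i <;> simp [v, c] <;> ring_nf
  · intro x hx
    rw [hT', hin2 x hx, ← hq]
    simp only [add_neg_cancel_right]
    rw [hC, hq]; exact hx


structure GoodW {ι : Type} (W : ι → Set R2) : Prop where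
  opn : ∀ a, IsOpen (W a)
  cvx : ∀ a, Convex ℝ (W a)
  disj : ∀ a b x, x ∈ W a → x ∈ W b → a = b
  per : ∀ a, ∀ w ∈ intLattice, ∃ b, ∀ x, x ∈ W a → x + w ∈ W b

def GG {ι : Type} (W : ι → Set R2) : Subgroup (R2 ≃ₜ R2) where
  carrier := {Φ | Φ ∈ PP ∧ (∀ a x, Φ x ∈ W a ↔ x ∈ W a) ∧ ∀ x, (∀ a, x ∉ W a) → Φ x = x}
  mul_mem' {F G} hF hG := ⟨mul_mem hF.1 hG.1, fun a x => by
      change F (G x) ∈ W a ↔ _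
      rw [hF.2.1, hG.2.1], fun x hx => by
      change F (G x) = x
      rw [hG.2.2 x hx, hF.2.2 x hx]⟩
  one_mem' := ⟨one_mem _, fun a x => Iff.rfl, fun x _ => rfl⟩
  inv_mem' {F} hF := ⟨inv_mem hF.1, fun a x => by
      change F.symm x ∈ W a ↔ _
      rw [← hF.2.1 a (F.symm x), Homeomorph.apply_symm_apply], fun x hx => by
      change F.symm x = x
      rw [Homeomorph.symm_apply_eq, hF.2.2 x hx]⟩

theorem GG_mono {ι : Type} {W W' : ι → Set R2} (h : ∀ a, W a ⊆ W' a)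
    (hd : ∀ a b x, x ∈ W' a → x ∈ W' b → a = b) : GG W ≤ GG W' := by
  intro Φ hΦ
  refine ⟨hΦ.1, fun a x => ?_, fun x hx => hΦ.2.2 x fun a ha => hx a (h a ha)⟩
  by_cases hx : ∃ b, x ∈ W b
  · obtain ⟨b, hb⟩ := hx
    have hb' := (hΦ.2.1 b x).2 hb
    constructor
    · intro h1
      rw [hd _ _ _ h1 (h b hb')]; exact h b hb
    · intro h1
      rw [hd _ _ _ h1 (h b hb)]; exact h b hb'
  · push Not at hx
    rw [hΦ.2.2 x hx]

theorem gg_of_ellipse {ι : Type} {W : ι → Set R2} (hW : GoodW W) {T : R2 ≃ₜ R2} (hT : T ∈ PP)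
    {α ρ : ℝ} {m : R2} {a : ι} (hsub : ∀ x, qf α m x < ρ ^ 2 → x ∈ W a)
    (h1 : ∀ x, (∀ w ∈ intLattice, ρ ^ 2 ≤ qf α m (x + w)) → T x = x)
    (h3 : ∀ x, qf α m x < ρ ^ 2 → qf α m (T x) < ρ ^ 2) : T ∈ GG W := by
  have key : ∀ x, T x = x ∨ ∃ b, x ∈ W b ∧ T x ∈ W b := by
    intro x
    by_cases h : ∀ w ∈ intLattice, ρ ^ 2 ≤ qf α m (x + w)
    · exact Or.inl (h1 x h)
    · push Not at h
      obtain ⟨w, hw, hlt⟩ := h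
      obtain ⟨b, hb⟩ := hW.per a (-w) (neg_mem hw)
      right
      refine ⟨b, ?_, ?_⟩
      · have := hb _ (hsub _ hlt); simpa using this
      · have := hb _ (hsub _ (h3 _ hlt)); rw [hT.1 _ _ hw] at this; simpa using this
  refine ⟨hT, fun c x => ?_, fun x hx => ?_⟩
  · rcases key x with h | ⟨b, hb, hb'⟩
    · rw [h]
    · constructor
      · intro h; rw [hW.disj _ _ _ h hb']; exact hb
      · intro h; rw [hW.disj _ _ _ h hb]; exact hb'
  · rcases key x with h | ⟨b, hb, hb'⟩
    · exact h
    · exact absurd hb (hx b)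

theorem lat_closed : IsClosed (intLattice : Set R2) := by
  have : (intLattice : Set R2) = ⋂ i, (fun x : R2 => x i) ⁻¹' (Set.range ((↑) : ℤ → ℝ)) := by
    ext x
    simp only [mem_iInter, mem_preimage, mem_range]
    exact forall_congr' fun i => exists_congr fun n => eq_comm
  rw [this]
  exact isClosed_iInter fun i => Int.isClosedEmbedding_coe_real.isClosed_range.preimage (by fun_prop)

def orb (Z : Set R2) : Set R2 := {x | ∃ z ∈ Z, x - z ∈ intLattice}

theorem orb_closed {Z : Set R2} (hZ : Z.Finite) : IsClosed (orb Z) := by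
  have : orb Z = ⋃ z ∈ Z, (fun x => x - z) ⁻¹' (intLattice : Set R2) := by
    ext x; simp [orb]
  rw [this]
  exact hZ.isClosed_biUnion fun z _ => lat_closed.preimage (by fun_prop)

theorem orb_countable {Z : Set R2} (hZ : Z.Finite) : (orb Z).Countable := by
  have : orb Z ⊆ ⋃ z ∈ Z, (fun x => x + z) '' (intLattice : Set R2) := by
    rintro x ⟨z, hz, hx⟩
    simp only [mem_iUnion]
    exact ⟨z, hz, x - z, hx, by simp⟩
  refine Countable.mono this (hZ.countable.biUnion fun z _ => Countable.image ?_ _)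
  exact Set.countable_coe_iff.1 (inferInstance : Countable intLattice)

theorem qf_one (m x : R2) : qf 1 m x = dist x m ^ 2 := by
  rw [EuclideanSpace.dist_eq, Real.sq_sqrt (by positivity)]
  simp [qf, Fin.sum_univ_two, Real.dist_eq, sq_abs]

theorem move_one {ι : Type} {W : ι → Set R2} (hW : GoodW W) {Z : Set R2} (hZ : Z.Finite)
    {a : ι} {x y : R2} (hx : x ∈ W a) (hy : y ∈ W a) (hxZ : x ∉ orb Z) (hyZ : y ∉ orb Z) :
    ∃ Φ ∈ GG W, Φ x = y ∧ ∀ z ∈ Z, Φ z = z := by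
  have hpre := convex_diff_countable (hW.cvx a) (hW.opn a) (orb_countable hZ)
  have hop : IsOpen (W a \ orb Z) := (hW.opn a).sdiff (orb_closed hZ)
  refine hpre.induction₂ (fun x y => ∃ Φ ∈ GG W, Φ x = y ∧ ∀ z ∈ Z, Φ z = z) ?_ ?_ ?_
    ⟨hx, hxZ⟩ ⟨hy, hyZ⟩
  · intro x hx
    obtain ⟨r0, hr0, hb0⟩ := Metric.isOpen_iff.1 hop x hx
    obtain ⟨r, hr, hr1, hrr⟩ : ∃ r > 0, r ≤ 1 ∧ r ≤ r0 := ⟨min 1 r0, by positivity, by simp, by simp⟩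
    have hb : ball x r ⊆ W a \ orb Z := (ball_subset_ball hrr).trans hb0
    refine mem_nhdsWithin_of_mem_nhds ?_
    filter_upwards [ball_mem_nhds x (show 0 < r / 2 by positivity)] with y hy
    let u : R2 := (1 / 2 : ℝ) • (x + y)
    have hxy : dist x y < r / 2 := by rw [dist_comm]; exact hy
    have hux : dist x u = dist x y / 2 := by
      rw [dist_eq_norm, dist_eq_norm]
      have : x - u = (1 / 2 : ℝ) • (x - y) := by simp only [u]; module
      rw [this, norm_smul]; norm_num; ring
    obtain ⟨T, hT, h1, h2, h3⟩ := ptwist_exists 1 one_pos le_rfl u (dist x y / 2) (r / 2) Real.pi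
      (by positivity) (by linarith) (by linarith)
    have hball : ∀ z, qf 1 u z < (r / 2) ^ 2 → z ∈ W a \ orb Z := by
      intro z hz
      rw [qf_one, sq_lt_sq₀ dist_nonneg (by linarith)] at hz
      apply hb
      have := dist_triangle z u x
      rw [dist_comm u x] at this
      rw [mem_ball]; linarith
    refine ⟨T, gg_of_ellipse hW hT (fun z hz => (hball z hz).1) h1 h3, ?_, ?_⟩
    · rw [h2 x (by rw [qf_one, hux])]
      ext i; fin_cases i <;> simp [u] <;> ring
    · intro z hz
      apply h1
      intro w hw
      by_contra hcon
      push Not at hcon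
      exact (hball _ hcon).2 ⟨z, hz, by simpa using hw⟩
  · rintro x y z _ _ _ ⟨Φ, hΦ, h1, h2⟩ ⟨Ψ, hΨ, h3, h4⟩
    refine ⟨Ψ * Φ, mul_mem hΨ hΦ, ?_, ?_⟩
    · change Ψ (Φ x) = z; rw [h1, h3]
    · intro u hu
      change Ψ (Φ u) = u; rw [h2 u hu, h4 u hu]
  · rintro x y _ _ ⟨Φ, hΦ, h1, h2⟩
    refine ⟨Φ⁻¹, inv_mem hΦ, ?_, ?_⟩
    · change Φ.symm y = x; rw [Homeomorph.symm_apply_eq, h1]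
    · intro u hu
      change Φ.symm u = u; rw [Homeomorph.symm_apply_eq, h2 u hu]


def InjL {κ : Type} (x : κ → R2) : Prop := ∀ e e', x e - x e' ∈ intLattice → e = e'

theorem Eqv.sub_mem {Φ : R2 ≃ₜ R2} (h : Eqv Φ) {x y : R2} (hxy : Φ x - Φ y ∈ intLattice) :
    x - y ∈ intLattice := by
  have := h y _ hxy
  rw [add_sub_cancel] at this
  have := Φ.injective this
  rw [← this]; simpa using hxy

theorem move_many {ι : Type} {W : ι → Set R2} (hW : GoodW W) {κ : Type} [Finite κ]
    (a : κ → ι) (x y : κ → R2) (hx : ∀ e, x e ∈ W (a e)) (hy : ∀ e, y e ∈ W (a e))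
    (hxi : InjL x) (hyi : InjL y) : ∃ Φ ∈ GG W, ∀ e, Φ (x e) = y e := by
  classical
  have := Fintype.ofFinite κ
  suffices h : ∀ s : Finset κ, ∃ Φ ∈ GG W, ∀ e ∈ s, Φ (x e) = y e by
    obtain ⟨Φ, h1, h2⟩ := h Finset.univ
    exact ⟨Φ, h1, fun e => h2 e (Finset.mem_univ _)⟩
  intro s
  induction s using Finset.induction_on with
  | empty => exact ⟨1, one_mem _, by simp⟩
  | insert e s hes ih =>
    obtain ⟨Φ, hΦ, hs⟩ := ih
    obtain ⟨Ψ, hΨ, h1, h2⟩ := move_one hW (Z := y '' (s : Set κ)) ((s.finite_toSet).image _)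
      (a := a e) (x := Φ (x e)) (y := y e) ((hΦ.2.1 _ _).2 (hx e)) (hy e) (by
        rintro ⟨_, ⟨e', he', rfl⟩, hm⟩
        rw [← hs e' he'] at hm
        have := hxi _ _ (Eqv.sub_mem hΦ.1.1 hm)
        exact hes (this ▸ he')) (by
        rintro ⟨_, ⟨e', he', rfl⟩, hm⟩
        have := hyi _ _ hm
        exact hes (this ▸ he'))
    refine ⟨Ψ * Φ, mul_mem hΨ hΦ, ?_⟩
    intro e' he'
    change Ψ (Φ (x e')) = y e'
    rcases Finset.mem_insert.1 he' with rfl | h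
    · exact h1
    · rw [hs e' h]; exact h2 _ ⟨e', h, rfl⟩


abbrev Ix : Type := ℤ × ℤ

def Sc (N : ℕ) (θ : ℝ) (a : Ix) : Set R2 :=
  {x | (a.1 : ℝ) < N * x 0 ∧ N * x 0 < a.1 + 1 ∧ a.2 + θ < N * x 1 ∧ N * x 1 < a.2 + 1 - θ}

def Cc (N : ℕ) (a : Ix) : Set R2 :=
  {x | (a.1 : ℝ) ≤ N * x 0 ∧ N * x 0 ≤ a.1 + 1 ∧ a.2 ≤ N * x 1 ∧ N * x 1 ≤ a.2 + 1}

def lv (k : Ix) : R2 := !₂[(k.1 : ℝ), (k.2 : ℝ)]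

def sh (N : ℕ) (k a : Ix) : Ix := (a.1 + N * k.1, a.2 + N * k.2)

theorem lv_mem (k : Ix) : lv k ∈ intLattice := by
  intro i; fin_cases i
  · exact ⟨k.1, rfl⟩
  · exact ⟨k.2, rfl⟩

theorem lv_surj {w : R2} (hw : w ∈ intLattice) : ∃ k, w = lv k := by
  obtain ⟨m, hm⟩ := hw 0
  obtain ⟨n, hn⟩ := hw 1
  refine ⟨(m, n), ?_⟩
  ext i; fin_cases i <;> simp [lv, hm, hn]

theorem Sc_sh {N : ℕ} {θ : ℝ} {a k : Ix} {x : R2} :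
    x + lv k ∈ Sc N θ (sh N k a) ↔ x ∈ Sc N θ a := by
  simp only [Sc, sh, lv, mem_ofPred_eq, PiLp.add_apply]
  simp only [Matrix.cons_val_zero, Matrix.cons_val_one]
  push_cast
  constructor <;> rintro ⟨h1, h2, h3, h4⟩ <;> refine ⟨?_, ?_, ?_, ?_⟩ <;> linarith

theorem Cc_sh {N : ℕ} {a k : Ix} {x : R2} :
    x + lv k ∈ Cc N (sh N k a) ↔ x ∈ Cc N a := by
  simp only [Cc, sh, lv, mem_ofPred_eq, PiLp.add_apply]
  simp only [Matrix.cons_val_zero, Matrix.cons_val_one]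
  push_cast
  constructor <;> rintro ⟨h1, h2, h3, h4⟩ <;> refine ⟨?_, ?_, ?_, ?_⟩ <;> linarith

theorem Sc_sub {N : ℕ} {θ θ' : ℝ} (h : θ' ≤ θ) (a : Ix) : Sc N θ a ⊆ Sc N θ' a :=
  fun x hx => ⟨hx.1, hx.2.1, by linarith [hx.2.2.1], by linarith [hx.2.2.2]⟩

theorem Sc_sub_Cc {N : ℕ} {θ : ℝ} (h : 0 ≤ θ) (a : Ix) : Sc N θ a ⊆ Cc N a :=
  fun x hx => ⟨hx.1.le, hx.2.1.le, by linarith [hx.2.2.1], by linarith [hx.2.2.2]⟩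

theorem Sc_Cc {N : ℕ} {θ : ℝ} (h : 0 ≤ θ) {a b : Ix} {x : R2} (h1 : x ∈ Sc N θ a)
    (h2 : x ∈ Cc N b) : a = b := by
  obtain ⟨p1, p2, p3, p4⟩ := h1
  obtain ⟨q1, q2, q3, q4⟩ := h2
  have e1 : (a.1 : ℝ) < b.1 + 1 := by linarith
  have e2 : (b.1 : ℝ) < a.1 + 1 := by linarith
  have e3 : (a.2 : ℝ) < b.2 + 1 := by linarith
  have e4 : (b.2 : ℝ) < a.2 + 1 := by linarith
  norm_cast at e1 e2 e3 e4
  ext <;> lia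

theorem Sc_good (N : ℕ) {θ : ℝ} (h : 0 ≤ θ) : GoodW (Sc N θ) where
  opn a := by
    refine IsOpen.and ?_ (IsOpen.and ?_ (IsOpen.and ?_ ?_)) <;>
    exact isOpen_lt (by fun_prop) (by fun_prop)
  cvx a := by
    rintro x ⟨p1, p2, p3, p4⟩ y ⟨q1, q2, q3, q4⟩ s t hs ht hst
    have key : ∀ c u v : ℝ, c < u → c < v → c < s * u + t * v := by
      intro c u v hu hv
      rcases hs.eq_or_lt with rfl | hs
      · have : t = 1 := by linarith
        subst this; linarith
      · have : t = 1 - s := by linarith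
        subst this
        nlinarith
    refine ⟨?_, ?_, ?_, ?_⟩ <;> simp only [PiLp.add_apply, PiLp.smul_apply, smul_eq_mul]
    · linarith [key _ _ _ p1 q1]
    · linarith [key _ _ _ (neg_lt_neg p2) (neg_lt_neg q2)]
    · linarith [key _ _ _ p3 q3]
    · linarith [key _ _ _ (neg_lt_neg p4) (neg_lt_neg q4)]
  disj a b x ha hb := Sc_Cc h ha (Sc_sub_Cc h b hb)
  per a w hw := by
    obtain ⟨k, rfl⟩ := lv_surj hw
    exact ⟨sh N k a, fun x hx => Sc_sh.2 hx⟩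

def cen (N : ℕ) (a : Ix) : R2 := !₂[((a.1 : ℝ) + 1 / 2) / N, ((a.2 : ℝ) + 1 / 2) / N]

theorem cen0 (N : ℕ) (a : Ix) : cen N a 0 = ((a.1 : ℝ) + 1 / 2) / N := rfl
theorem cen1 (N : ℕ) (a : Ix) : cen N a 1 = ((a.2 : ℝ) + 1 / 2) / N := rfl

theorem Cc_closure {N : ℕ} (hN : 0 < N) (a : Ix) : Cc N a ⊆ closure (Sc N 0 a) := by
  intro x hx
  have hN' : (0 : ℝ) < N := by exact_mod_cast hN
  have ht : Tendsto (fun t : ℝ => x + t • (cen N a - x)) (𝓝[>] 0) (𝓝 x) := by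
    have : Tendsto (fun t : ℝ => x + t • (cen N a - x)) (𝓝 0) (𝓝 (x + (0 : ℝ) • (cen N a - x))) :=
      Continuous.tendsto (by fun_prop) _
    rw [zero_smul, add_zero] at this
    exact this.mono_left nhdsWithin_le_nhds
  refine mem_closure_of_tendsto ht ?_
  filter_upwards [Ioo_mem_nhdsGT (show (0 : ℝ) < 1 by norm_num)] with t ht
  obtain ⟨q1, q2, q3, q4⟩ := hx
  have e0 : N * cen N a 0 = a.1 + 1 / 2 := by rw [cen0]; field_simp
  have e1 : N * cen N a 1 = a.2 + 1 / 2 := by rw [cen1]; field_simp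
  obtain ⟨t0, t1⟩ := ht
  refine ⟨?_, ?_, ?_, ?_⟩ <;>
    simp only [PiLp.add_apply, PiLp.smul_apply, PiLp.sub_apply, smul_eq_mul, mul_add, mul_sub]
  · have : N * (t * cen N a 0) = t * (a.1 + 1 / 2) := by rw [← e0]; ring
    rw [this]; nlinarith
  · have : N * (t * cen N a 0) = t * (a.1 + 1 / 2) := by rw [← e0]; ring
    rw [this]; nlinarith
  · have : N * (t * cen N a 1) = t * (a.2 + 1 / 2) := by rw [← e1]; ring
    rw [this]; nlinarith
  · have : N * (t * cen N a 1) = t * (a.2 + 1 / 2) := by rw [← e1]; ring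
    rw [this]; nlinarith

theorem Cc_closed (N : ℕ) (a : Ix) : IsClosed (Cc N a) := by
  refine IsClosed.and ?_ (IsClosed.and ?_ (IsClosed.and ?_ ?_)) <;>
    exact isClosed_le (by fun_prop) (by fun_prop)

theorem dist_le_coord (x y : R2) : dist x y ≤ |x 0 - y 0| + |x 1 - y 1| := by
  rw [EuclideanSpace.dist_eq, Fin.sum_univ_two, Real.dist_eq, Real.dist_eq]
  apply Real.sqrt_le_iff.2
  exact ⟨by positivity, by nlinarith [mul_nonneg (abs_nonneg (x 0 - y 0)) (abs_nonneg (x 1 - y 1))]⟩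

theorem coord_le_dist (x y : R2) (i : Fin 2) : |x i - y i| ≤ dist x y := by
  rw [dist_eq_norm]
  exact PiLp.norm_apply_le (x - y) i

theorem Cc_dist {N : ℕ} (hN : 0 < N) {a : Ix} {x y : R2} (hx : x ∈ Cc N a) (hy : y ∈ Cc N a) :
    dist x y ≤ 2 / N := by
  have hN' : (0 : ℝ) < N := by exact_mod_cast hN
  obtain ⟨p1, p2, p3, p4⟩ := hx
  obtain ⟨q1, q2, q3, q4⟩ := hy
  refine (dist_le_coord x y).trans ?_
  rw [le_div_iff₀ hN', add_mul]
  have h0 : |x 0 - y 0| * N ≤ 1 := by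
    rw [← abs_of_pos hN', ← abs_mul, abs_le]; constructor <;> nlinarith
  have h1 : |x 1 - y 1| * N ≤ 1 := by
    rw [← abs_of_pos hN', ← abs_mul, abs_le]; constructor <;> nlinarith
  linarith

theorem Cc_compact {N : ℕ} (hN : 0 < N) (a : Ix) : IsCompact (Cc N a) := by
  refine Metric.isCompact_of_isClosed_isBounded (Cc_closed N a) ?_
  exact Metric.isBounded_iff.2 ⟨_, fun x hx y hy => Cc_dist hN hx hy⟩

theorem Cc_cover (N : ℕ) (x : R2) : x ∈ Cc N (⌊N * x 0⌋, ⌊N * x 1⌋) :=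
  ⟨Int.floor_le _, (Int.lt_floor_add_one _).le, Int.floor_le _, (Int.lt_floor_add_one _).le⟩

theorem Cc_finite {N : ℕ} {K : Set R2} (hK : Bornology.IsBounded K) :
    {b | (Cc N b ∩ K).Nonempty}.Finite := by
  obtain ⟨R, hR⟩ := hK.subset_closedBall 0
  obtain ⟨M, hM⟩ := exists_nat_gt (N * R + 1)
  refine Set.Finite.subset (Set.finite_Icc ((-M, -M) : Ix) (M, M)) ?_
  rintro b ⟨x, ⟨q1, q2, q3, q4⟩, hx⟩
  have hx0 : dist x 0 ≤ R := hR hx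
  have h0 := (coord_le_dist x 0 0).trans hx0
  have h1 := (coord_le_dist x 0 1).trans hx0
  have hN' : (0 : ℝ) ≤ N := by positivity
  simp only [PiLp.zero_apply, sub_zero, abs_le] at h0 h1
  have a1 : N * x 0 ≤ N * R := mul_le_mul_of_nonneg_left h0.2 hN'
  have a2 : N * (-R) ≤ N * x 0 := mul_le_mul_of_nonneg_left h0.1 hN'
  have a3 : N * x 1 ≤ N * R := mul_le_mul_of_nonneg_left h1.2 hN'
  have a4 : N * (-R) ≤ N * x 1 := mul_le_mul_of_nonneg_left h1.1 hN'
  have b1 : (b.1 : ℝ) < M := by linarith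
  have b2 : (-M : ℝ) < b.1 := by linarith
  have b3 : (b.2 : ℝ) < M := by linarith
  have b4 : (-M : ℝ) < b.2 := by linarith
  refine ⟨⟨?_, ?_⟩, ⟨?_, ?_⟩⟩ <;> simp only
  · have : ((-M : ℤ) : ℝ) < b.1 := by push_cast; exact b2
    exact_mod_cast this.le
  · have : ((-M : ℤ) : ℝ) < b.2 := by push_cast; exact b4
    exact_mod_cast this.le
  · exact_mod_cast b1.le
  · exact_mod_cast b3.le

/-- base cells -/
def Bs (N : ℕ) : Set Ix := {a | 0 ≤ a.1 ∧ a.1 < N ∧ 0 ≤ a.2 ∧ a.2 < N}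

theorem Bs_finite (N : ℕ) : (Bs N).Finite := by
  refine Set.Finite.subset (Set.finite_Icc ((0, 0) : Ix) (N, N)) ?_
  rintro a ⟨h1, h2, h3, h4⟩
  exact ⟨⟨h1, h3⟩, ⟨h2.le, h4.le⟩⟩

theorem Bs_repr {N : ℕ} (hN : 0 < N) (a : Ix) : ∃ k, ∃ a0 ∈ Bs N, sh N k a0 = a := by
  have hN' : (0 : ℤ) < N := by exact_mod_cast hN
  refine ⟨(a.1 / N, a.2 / N), (a.1 % N, a.2 % N), ⟨Int.emod_nonneg _ hN'.ne', Int.emod_lt_of_pos _ hN',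
    Int.emod_nonneg _ hN'.ne', Int.emod_lt_of_pos _ hN'⟩, ?_⟩
  ext <;> simp [sh, Int.emod_add_mul_ediv]

theorem sh_add (N : ℕ) (k l a : Ix) : sh N k (sh N l a) = sh N (k + l) a := by
  ext <;> simp [sh] <;> ring

theorem sh_zero (N : ℕ) (a : Ix) : sh N 0 a = a := by
  ext <;> simp [sh]

theorem lv_add (k l : Ix) : lv (k + l) = lv k + lv l := by
  ext i; fin_cases i <;> simp [lv]

/-- points of base cells that agree modulo the lattice -/
theorem Bs_unique {N : ℕ} {a b k : Ix} (ha : a ∈ Bs N) (hb : b ∈ Bs N)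
    (h : sh N k a = b) : k = 0 ∧ a = b := by
  obtain ⟨h1, h2, h3, h4⟩ := ha
  obtain ⟨g1, g2, g3, g4⟩ := hb
  have e1 : a.1 + N * k.1 = b.1 := congrArg Prod.fst h
  have e2 : a.2 + N * k.2 = b.2 := congrArg Prod.snd h
  have k1 : k.1 = 0 := by
    by_contra hk
    rcases lt_or_gt_of_ne hk with h | h
    · nlinarith
    · nlinarith
  have k2 : k.2 = 0 := by
    by_contra hk
    rcases lt_or_gt_of_ne hk with h | h
    · nlinarith
    · nlinarith
  have hk : k = 0 := Prod.ext k1 k2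
  subst hk
  exact ⟨rfl, by rw [sh_zero] at h; exact h⟩

theorem GG_Cc {N : ℕ} {θ : ℝ} (h : 0 ≤ θ) {Φ : R2 ≃ₜ R2} (hΦ : Φ ∈ GG (Sc N θ)) (a : Ix) (x : R2) :
    Φ x ∈ Cc N a ↔ x ∈ Cc N a := by
  by_cases hx : ∃ b, x ∈ Sc N θ b
  · obtain ⟨b, hb⟩ := hx
    have hb' := (hΦ.2.1 b x).2 hb
    constructor
    · intro h1; rw [← Sc_Cc h hb' h1]; exact Sc_sub_Cc h _ hb
    · intro h1; rw [← Sc_Cc h hb h1]; exact Sc_sub_Cc h _ hb'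
  · push Not at hx
    rw [hΦ.2.2 x hx]

theorem GG_dist {N : ℕ} (hN : 0 < N) {θ : ℝ} (h : 0 ≤ θ) {Φ : R2 ≃ₜ R2} (hΦ : Φ ∈ GG (Sc N θ))
    (x : R2) : dist (Φ x) x ≤ 2 / N :=
  Cc_dist hN ((GG_Cc h hΦ _ x).2 (Cc_cover N x)) (Cc_cover N x)


theorem one_dim {f : ℝ → ℝ} (hf : Continuous f) {c d α β : ℝ} (hcd : c ≤ d) (hα : f c ≤ α)
    (hαβ : α ≤ β) (hβ : β ≤ f d) :
    ∃ c' d', c ≤ c' ∧ c' ≤ d' ∧ d' ≤ d ∧ f c' = α ∧ f d' = β ∧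
      ∀ t, c' ≤ t → t ≤ d' → α ≤ f t ∧ f t ≤ β := by
  have hc1 : IsCompact (Icc c d ∩ f ⁻¹' Ici β) :=
    isCompact_Icc.inter_right (isClosed_Ici.preimage hf)
  obtain ⟨d', hd', hleast⟩ := hc1.exists_isLeast ⟨d, ⟨hcd, le_rfl⟩, hβ⟩
  have hd'eq : f d' = β := by
    obtain ⟨t, ht, hft⟩ := intermediate_value_Icc hd'.1.1 hf.continuousOn
      (show β ∈ Icc (f c) (f d') from ⟨hα.trans hαβ, hd'.2⟩)
    have := hleast ⟨⟨ht.1, ht.2.trans hd'.1.2⟩, hft.ge⟩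
    rw [← hft, le_antisymm this ht.2]
  have hc2 : IsCompact (Icc c d' ∩ f ⁻¹' Iic α) :=
    isCompact_Icc.inter_right (isClosed_Iic.preimage hf)
  obtain ⟨c', hc', hgr⟩ := hc2.exists_isGreatest ⟨c, ⟨le_rfl, hd'.1.1⟩, hα⟩
  have hc'eq : f c' = α := by
    obtain ⟨t, ht, hft⟩ := intermediate_value_Icc hc'.1.2 hf.continuousOn
      (show α ∈ Icc (f c') (f d') from ⟨hc'.2, by rw [hd'eq]; exact hαβ⟩)
    have := hgr ⟨⟨hc'.1.1.trans ht.1, ht.2⟩, hft.le⟩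
    rw [← hft, le_antisymm ht.1 this]
  refine ⟨c', d', hc'.1.1, hc'.1.2, hd'.1.2, hc'eq, hd'eq, ?_⟩
  intro t h1 h2
  constructor
  · by_contra hcon
    push Not at hcon
    have := hgr ⟨⟨hc'.1.1.trans h1, h2⟩, hcon.le⟩
    have : t = c' := le_antisymm this h1
    rw [this, hc'eq] at hcon; exact lt_irrefl _ hcon
  · by_contra hcon
    push Not at hcon
    have := hleast ⟨⟨hc'.1.1.trans h1, h2.trans hd'.1.2⟩, hcon.le⟩
    have : t = d' := le_antisymm h2 this
    rw [this, hd'eq] at hcon; exact lt_irrefl _ hcon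

def core (N : ℕ) (θ : ℝ) (a : Ix) : Set R2 :=
  {x | a.1 + 1 / 4 ≤ N * x 0 ∧ N * x 0 ≤ a.1 + 3 / 4 ∧ a.2 + θ ≤ N * x 1 ∧ N * x 1 ≤ a.2 + 1 - θ}

theorem core_sub {N : ℕ} {θ : ℝ} (h : 0 ≤ θ) (a : Ix) : core N θ a ⊆ Cc N a := by
  rintro x ⟨h1, h2, h3, h4⟩
  refine ⟨?_, ?_, ?_, ?_⟩ <;> linarith

/-- The neck condition. -/
def NeckProp (N : ℕ) (θ : ℝ) (E : Ix → Ix → Prop) (G : R2 → R2) : Prop :=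
  ∀ a b, E a b → ∃ s1 s2 : ℝ, a.1 + 1 / 4 ≤ s1 ∧ s1 ≤ s2 ∧ s2 ≤ a.1 + 3 / 4 ∧
    ∀ p : R2, s1 ≤ N * p 0 → N * p 0 ≤ s2 → a.2 + θ ≤ N * p 1 → N * p 1 ≤ a.2 + 1 - θ →
      (b.2 + θ ≤ N * G p 1 ∧ N * G p 1 ≤ b.2 + 1 - θ) ∧
      (N * p 0 = s1 → N * G p 0 ≤ b.1 + 1 / 4) ∧ (N * p 0 = s2 → b.1 + 3 / 4 ≤ N * G p 0)

theorem walk_path {N : ℕ} (hN : 0 < N) {θ : ℝ} (hθ : θ ≤ 1 / 2) {E : Ix → Ix → Prop}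
    {G : R2 → R2} (hG : Continuous G) (hnk : NeckProp N θ E G) (a : ℕ → Ix) (n : ℕ)
    (ha : ∀ i < n, E (a i) (a (i + 1))) :
    ∃ (γ : ℝ → R2) (c d : ℝ), Continuous γ ∧ c ≤ d ∧
      (∀ t, c ≤ t → t ≤ d → ∀ i ≤ n, G^[i] (γ t) ∈ core N θ (a i)) ∧
      N * (G^[n] (γ c)) 0 = (a n).1 + 1 / 4 ∧ N * (G^[n] (γ d)) 0 = (a n).1 + 3 / 4 := by
  have hN' : (0 : ℝ) < N := by exact_mod_cast hN
  induction n with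
  | zero =>
    refine ⟨fun t => !₂[t / N, ((a 0).2 + 1 / 2) / N], (a 0).1 + 1 / 4, (a 0).1 + 3 / 4, ?_, ?_, ?_,
      ?_, ?_⟩
    · fun_prop
    · linarith
    · intro t h1 h2 i hi
      obtain rfl : i = 0 := by lia
      refine ⟨?_, ?_, ?_, ?_⟩ <;> simp [mul_div_cancel₀ _ hN'.ne'] <;> linarith
    · simp [mul_div_cancel₀ _ hN'.ne']
    · simp [mul_div_cancel₀ _ hN'.ne']
  | succ n ih =>
    obtain ⟨γ, c, d, hγ, hcd, hin, hc, hd⟩ := ih fun i hi => ha i (by lia)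
    obtain ⟨s1, s2, k1, k2, k3, hk⟩ := hnk _ _ (ha n (by lia))
    have hq : Continuous fun t => N * (G^[n] (γ t)) 0 := by
      have := (hG.iterate n).comp hγ
      have h2 : Continuous fun t => (G^[n] (γ t)) 0 := by
        exact (by fun_prop : Continuous fun x : R2 => x 0).comp this
      fun_prop
    obtain ⟨c1, d1, e1, e2, e3, e4, e5, e6⟩ := one_dim hq hcd (α := s1) (β := s2)
      (by rw [hc]; exact k1) k2 (by rw [hd]; exact k3)
    have hq2 : Continuous fun t => N * (G^[n + 1] (γ t)) 0 := by
      have := (hG.iterate (n + 1)).comp hγ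
      have h2 : Continuous fun t => (G^[n + 1] (γ t)) 0 := by
        exact (by fun_prop : Continuous fun x : R2 => x 0).comp this
      fun_prop
    have hst : ∀ t, c1 ≤ t → t ≤ d1 → _ := fun t h1 h2 =>
      hk (G^[n] (γ t)) (e6 t h1 h2).1 (e6 t h1 h2).2
        (hin t (e1.trans h1) (h2.trans e3) n le_rfl).2.2.1
        (hin t (e1.trans h1) (h2.trans e3) n le_rfl).2.2.2
    obtain ⟨c2, d2, f1, f2, f3, f4, f5, f6⟩ := one_dim hq2 e2 (α := (a (n + 1)).1 + 1 / 4)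
      (β := (a (n + 1)).1 + 3 / 4)
      (by rw [Function.iterate_succ_apply']; exact (hst c1 le_rfl e2).2.1 e4) (by linarith)
      (by rw [Function.iterate_succ_apply']; exact (hst d1 e2 le_rfl).2.2 e5)
    refine ⟨γ, c2, d2, hγ, f2, ?_, f4, f5⟩
    intro t h1 h2 i hi
    rcases Nat.lt_or_ge i (n + 1) with h | h
    · exact hin t (by linarith) (by linarith) i (by lia)
    · obtain rfl : i = n + 1 := by lia
      refine ⟨(f6 t h1 h2).1, (f6 t h1 h2).2, ?_⟩
      rw [Function.iterate_succ_apply']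
      exact (hst t (by linarith) (by linarith)).1

theorem rot_incl {N : ℕ} (hN : 0 < N) {θ : ℝ} (hθ0 : 0 ≤ θ) (hθ : θ ≤ 1 / 2) {E : Ix → Ix → Prop}
    {G' G : R2 ≃ₜ R2} (hA : ∀ a b x, x ∈ Cc N a → G' x ∈ Cc N b → E a b)
    (hB : NeckProp N θ E G) : rotSet G' ⊆ rotSet G := by
  rintro v ⟨z, n, hn, hv⟩
  have key : ∀ k, ∃ y : R2, ∀ i ≤ n k, dist (G'^[i] (z k)) (G^[i] y) ≤ 2 / N := by
    intro k
    obtain ⟨γ, c, d, -, hcd, hin, -⟩ := walk_path hN hθ G.continuous hB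
      (fun i => (⌊N * (G'^[i] (z k)) 0⌋, ⌊N * (G'^[i] (z k)) 1⌋)) (n k) (fun i _ => by
        refine hA _ _ (G'^[i] (z k)) (Cc_cover _ _) ?_
        rw [← Function.iterate_succ_apply' (⇑G') i (z k)]
        exact Cc_cover _ _)
    exact ⟨γ c, fun i hi => Cc_dist hN (Cc_cover _ _) (core_sub hθ0 _ (hin c le_rfl hcd i hi))⟩
  choose y hy using key
  refine ⟨y, n, hn, ?_⟩
  have hdiff : Tendsto (fun k => (n k : ℝ)⁻¹ • ((G^[n k] (y k) - y k) - (G'^[n k] (z k) - z k)))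
      atTop (𝓝 0) := by
    rw [tendsto_zero_iff_norm_tendsto_zero]
    have hb : Tendsto (fun k => (n k : ℝ)⁻¹ * (4 / N)) atTop (𝓝 0) := by
      have := (tendsto_inv_atTop_zero.comp (tendsto_natCast_atTop_atTop.comp hn)).mul_const
        ((4 : ℝ) / N)
      rw [zero_mul] at this
      exact this
    refine squeeze_zero (fun _ => norm_nonneg _) (fun k => ?_) hb
    rw [norm_smul, norm_inv, RCLike.norm_natCast]
    refine mul_le_mul_of_nonneg_left ?_ (by positivity)
    have h1 := hy k (n k) le_rfl
    have h2 := hy k 0 (Nat.zero_le _)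
    simp only [Function.iterate_zero, id] at h2
    have : (G^[n k] (y k) - y k) - (G'^[n k] (z k) - z k) =
        (z k - y k) - (G'^[n k] (z k) - G^[n k] (y k)) := by abel
    rw [this]
    refine (norm_sub_le _ _).trans ?_
    rw [← dist_eq_norm, ← dist_eq_norm]
    have : (4 : ℝ) / N = 2 / N + 2 / N := by ring
    linarith
  have := hv.add hdiff
  rw [add_zero] at this
  refine this.congr fun k => ?_
  rw [← smul_add]; congr 1; abel


theorem baire_shift (F : R2 ≃ₜ R2) {N : ℕ} (hN : 0 < N) {ε : ℝ} (hε : 0 < ε) :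
    ∃ v : R2, ‖v‖ < ε ∧ ∀ a b, (∃ x ∈ Cc N a, F x + v ∈ Cc N b) →
      ∃ x ∈ Sc N 0 a, F x + v ∈ Sc N 0 b := by
  let A : Ix × Ix → Set R2 := fun e => {v | ∃ x ∈ Sc N 0 e.1, F x + v ∈ Sc N 0 e.2}
  let B : Ix × Ix → Set R2 := fun e => {v | ∃ x ∈ Cc N e.1, F x + v ∈ Cc N e.2}
  have hA : ∀ e, IsOpen (A e) := by
    intro e
    have : A e = ⋃ x ∈ Sc N 0 e.1, (fun v => F x + v) ⁻¹' (Sc N 0 e.2) := by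
      ext v; simp [A]
    rw [this]
    exact isOpen_biUnion fun x _ => ((Sc_good N le_rfl).opn _).preimage (by fun_prop)
  have hB : ∀ e, IsClosed (B e) := by
    intro e
    have : B e = (fun z : R2 × R2 => z.2 - F z.1) '' (Cc N e.1 ×ˢ Cc N e.2) := by
      ext v
      constructor
      · rintro ⟨x, hx, hx2⟩
        exact ⟨(x, F x + v), ⟨hx, hx2⟩, by simp⟩
      · rintro ⟨⟨x, y⟩, ⟨hx, hy⟩, rfl⟩
        exact ⟨x, hx, by simpa using hy⟩
    rw [this]
    refine IsCompact.isClosed (((Cc_compact hN _).prod (Cc_compact hN _)).image ?_)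
    have := F.continuous
    fun_prop
  have hd : Dense (⋂ e : Ix × Ix, A e ∪ (B e)ᶜ) := by
    refine dense_iInter_of_isOpen (fun e => (hA e).union (hB e).isOpen_compl) fun e => ?_
    intro v
    by_cases hv : v ∈ B e
    · refine closure_mono subset_union_left ?_
      obtain ⟨x, hx, hx2⟩ := hv
      rw [Metric.mem_closure_iff]
      intro r hr
      have h1 : F x ∈ closure (F '' Sc N 0 e.1) :=
        image_closure_subset_closure_image F.continuous ⟨x, Cc_closure hN _ hx, rfl⟩
      obtain ⟨_, ⟨x', hx', rfl⟩, hd1⟩ := Metric.mem_closure_iff.1 h1 (r / 2) (by positivity)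
      obtain ⟨y', hy', hd2⟩ := Metric.mem_closure_iff.1 (Cc_closure hN _ hx2) (r / 2) (by positivity)
      refine ⟨y' - F x', ⟨x', hx', by simpa using hy'⟩, ?_⟩
      rw [dist_eq_norm] at *
      have : v - (y' - F x') = (F x + v - y') - (F x - F x') := by abel
      rw [this]
      refine (norm_sub_le _ _).trans_lt (by linarith)
    · exact subset_closure (Or.inr hv)
  obtain ⟨v, hv1, hv2⟩ := hd.exists_mem_open isOpen_ball ⟨(0 : R2), mem_ball_self hε⟩
  refine ⟨v, by simpa using hv2, fun a b hab => ?_⟩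
  rcases mem_iInter.1 hv1 (a, b) with h | h
  · exact h
  · exact absurd hab h

def Pt (N : ℕ) (a : Ix) (s t : ℝ) : R2 := !₂[(a.1 + 1 / 2 + s) / N, (a.2 + 1 / 2 + t) / N]

theorem Pt0 {N : ℕ} (hN : 0 < N) (a : Ix) (s t : ℝ) : N * Pt N a s t 0 = a.1 + 1 / 2 + s := by
  have hN' : (0 : ℝ) < N := by exact_mod_cast hN
  simp [Pt]; field_simp

theorem Pt1 {N : ℕ} (hN : 0 < N) (a : Ix) (s t : ℝ) : N * Pt N a s t 1 = a.2 + 1 / 2 + t := by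
  have hN' : (0 : ℝ) < N := by exact_mod_cast hN
  simp [Pt]; field_simp

theorem Pt_eq {N : ℕ} (hN : 0 < N) (a : Ix) (p : R2) :
    p = Pt N a (N * p 0 - a.1 - 1 / 2) (N * p 1 - a.2 - 1 / 2) := by
  have hN' : (0 : ℝ) < N := by exact_mod_cast hN
  ext i; fin_cases i <;> simp [Pt] <;> field_simp <;> ring

theorem Pt_mem {N : ℕ} (hN : 0 < N) {θ : ℝ} (a : Ix) {s t : ℝ} (hs : |s| < 1 / 2)
    (ht : |t| < 1 / 2 - θ) : Pt N a s t ∈ Sc N θ a := by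
  rw [abs_lt] at hs ht
  refine ⟨?_, ?_, ?_, ?_⟩
  · rw [Pt0 hN]; linarith
  · rw [Pt0 hN]; linarith
  · rw [Pt1 hN]; linarith
  · rw [Pt1 hN]; linarith

theorem Pt_injL {N : ℕ} (hN : 0 < N) {κ : Type} (c : κ → Ix) (s τ : κ → ℝ)
    (hτ : Function.Injective τ) (hb : ∀ i, |τ i| < 1 / 2) :
    InjL fun i => Pt N (c i) (s i) (τ i) := by
  intro e e' h
  apply hτ
  obtain ⟨k, hk⟩ := h 1
  have h1 := Pt1 hN (c e) (s e) (τ e)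
  have h2 := Pt1 hN (c e') (s e') (τ e')
  have h3 : N * Pt N (c e) (s e) (τ e) 1 - N * Pt N (c e') (s e') (τ e') 1 = N * k := by
    rw [← mul_sub]; congr 1
  rw [h1, h2] at h3
  have b1 := abs_lt.1 (hb e)
  have b2 := abs_lt.1 (hb e')
  have h4 : τ e - τ e' = ((N * k - (c e).2 + (c e').2 : ℤ) : ℝ) := by push_cast; linarith
  have h5 : (N * k - (c e).2 + (c e').2 : ℤ) = 0 := by
    have u1 : ((N * k - (c e).2 + (c e').2 : ℤ) : ℝ) < 1 := by rw [← h4]; linarith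
    have u2 : (-1 : ℝ) < ((N * k - (c e).2 + (c e').2 : ℤ) : ℝ) := by rw [← h4]; linarith
    norm_cast at u1 u2
    have u2' : -1 < (N * k - (c e).2 + (c e').2 : ℤ) := by exact_mod_cast u2
    lia
  rw [h5] at h4
  push_cast at h4; linarith

def sclL (c : ℝ) (hc : c ≠ 0) : R2 ≃L[ℝ] R2 :=
  ContinuousLinearEquiv.smulLeft (Units.mk0 c hc)

theorem sclL_apply (c : ℝ) (hc : c ≠ 0) (x : R2) : sclL c hc x = c • x := rfl
theorem sclL_symm_apply (c : ℝ) (hc : c ≠ 0) (x : R2) : (sclL c hc).symm x = c⁻¹ • x := rfl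

theorem conj_mp' (A : R2 ≃L[ℝ] R2) (T : R2 ≃ₜ R2) (hT : MeasurePreserving T volume volume) :
    MeasurePreserving (fun x => A (T (A.symm x))) (volume : Measure R2) volume := by
  have mA : Measurable A := A.continuous.measurable
  have mA' : Measurable A.symm := A.symm.continuous.measurable
  have mT : Measurable T := T.continuous.measurable
  refine ⟨mA.comp (mT.comp mA'), ?_⟩
  have h0 : (fun x => A (T (A.symm x))) = A ∘ T ∘ A.symm := rfl
  have : (Measure.map A.symm (volume : Measure R2)).IsAddHaarMeasure :=
    ContinuousLinearEquiv.isAddHaarMeasure_map A.symm volume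
  obtain ⟨c, hc⟩ : ∃ c : ENNReal, Measure.map A.symm (volume : Measure R2) = c • volume :=
    ⟨_, Measure.isAddLeftInvariant_eq_smul _ _⟩
  rw [h0, ← Measure.map_map mA (mT.comp mA'), ← Measure.map_map mT mA', hc, Measure.map_smul,
    hT.map_eq, ← hc, Measure.map_map mA mA']
  simp

theorem lam_exists {N : ℕ} (hN : 0 < N) {θ α : ℝ} (hα : 0 < α) (hα1 : α ≤ 1) (hθ : 0 < θ)
    (hθ1 : θ ≤ 1 / 2) :
    ∃ Λ ∈ GG (Sc N 0), ∀ a s t, |s| ≤ α * (θ / 2) → |t| ≤ 1 / 2 - θ →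
      Λ (Pt N a s t) = Pt N a (-(α * t)) (s / α) := by
  have hN' : (0 : ℝ) < N := by exact_mod_cast hN
  let m : R2 := !₂[1 / 2, 1 / 2]
  obtain ⟨T, hT, h1, h2, h3⟩ := ptwist_exists α hα hα1 m (1 / 2 - θ / 4) (1 / 2) (Real.pi / 2)
    (by linarith) (by linarith) le_rfl
  have hTG : T ∈ GG (Sc 1 0) := by
    refine gg_of_ellipse (Sc_good 1 le_rfl) hT (a := (0, 0)) (fun x hx => ?_) h1 h3
    have e0 : (x 0 - 1 / 2) ^ 2 ≤ ((x 0 - 1 / 2) / α) ^ 2 := by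
      rw [div_pow, le_div_iff₀ (by positivity)]
      have : α ^ 2 ≤ 1 := by nlinarith
      nlinarith [sq_nonneg (x 0 - 1 / 2)]
    have e1 : ((x 0 - 1 / 2) / α) ^ 2 + (x 1 - 1 / 2) ^ 2 < (1 / 2) ^ 2 := by simpa [qf, m] using hx
    have a0 : |x 0 - 1 / 2| < 1 / 2 := abs_lt_of_sq_lt_sq
      (by nlinarith [sq_nonneg (x 1 - 1 / 2)]) (by norm_num)
    have a1 : |x 1 - 1 / 2| < 1 / 2 := abs_lt_of_sq_lt_sq
      (by nlinarith [sq_nonneg ((x 0 - 1 / 2) / α)]) (by norm_num)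
    rw [abs_lt] at a0 a1
    refine ⟨?_, ?_, ?_, ?_⟩ <;> simp <;> linarith
  let A := sclL ((N : ℝ)⁻¹) (by positivity)
  let Λ : R2 ≃ₜ R2 := A.symm.toHomeomorph.trans (T.trans A.toHomeomorph)
  have hΛ : ∀ x, Λ x = (N : ℝ)⁻¹ • T ((N : ℝ) • x) := by
    intro x
    change A (T (A.symm x)) = _
    rw [sclL_symm_apply, sclL_apply, inv_inv]
  have hNΛ : ∀ x, (N : ℝ) • Λ x = T ((N : ℝ) • x) := by
    intro x; rw [hΛ, smul_inv_smul₀ hN'.ne']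
  have hsc : ∀ a x, x ∈ Sc N 0 a ↔ (N : ℝ) • x ∈ Sc 1 0 a := by
    intro a x
    simp [Sc]
  refine ⟨Λ, ⟨⟨?_, conj_mp' A T hT.2⟩, ?_, ?_⟩, ?_⟩
  · intro x w hw
    have hNw : (N : ℝ) • w ∈ intLattice := by
      rw [Nat.cast_smul_eq_nsmul]; exact nsmul_mem hw N
    rw [hΛ, hΛ, smul_add, hT.1 _ _ hNw, smul_add, inv_smul_smul₀ hN'.ne']
  · intro a x
    rw [hsc, hsc, hNΛ, hTG.2.1]
  · intro x hx
    rw [hΛ, hTG.2.2 _ (fun a => by rw [← hsc]; exact hx a), inv_smul_smul₀ hN'.ne']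
  · intro a s t hs ht
    have e : (N : ℝ) • Pt N a s t = !₂[1 / 2 + s, 1 / 2 + t] + lv a := by
      ext i; fin_cases i
      · simpa [lv, add_comm, add_left_comm] using Pt0 hN a s t
      · simpa [lv, add_comm, add_left_comm] using Pt1 hN a s t
    rw [hΛ, e, hT.1 _ _ (lv_mem a), h2]
    · simp only [Real.cos_pi_div_two, Real.sin_pi_div_two, m]
      ext i; fin_cases i <;> simp [lv, Pt] <;> field_simp <;> ring
    · have hs2 : (s / α) ^ 2 ≤ (θ / 2) ^ 2 := by
        rw [sq_le_sq, abs_div, abs_of_pos hα, abs_of_pos (by positivity : 0 < θ / 2),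
          div_le_iff₀ hα]
        linarith
      have ht2 : t ^ 2 ≤ (1 / 2 - θ) ^ 2 := by
        rw [sq_le_sq, abs_of_nonneg (by linarith : 0 ≤ 1 / 2 - θ)]
        exact ht
      have : qf α m !₂[1 / 2 + s, 1 / 2 + t] = (s / α) ^ 2 + t ^ 2 := by simp [qf, m]
      rw [this]
      nlinarith


def Edg (N : ℕ) (F : R2 → R2) (a b : Ix) : Prop := ∃ x ∈ Sc N 0 a, F x ∈ Sc N 0 b

def BE (N : ℕ) (F : R2 → R2) : Type := {e : Ix × Ix // e.1 ∈ Bs N ∧ Edg N F e.1 e.2}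

theorem BE_finite {N : ℕ} (hN : 0 < N) (F : R2 ≃ₜ R2) : Finite (BE N F) := by
  have : {e : Ix × Ix | e.1 ∈ Bs N ∧ Edg N F e.1 e.2}.Finite := by
    have h : (⋃ a ∈ Bs N, (fun b => (a, b)) '' {b | (Cc N b ∩ F '' Cc N a).Nonempty}).Finite :=
      (Bs_finite N).biUnion fun a _ =>
        (Cc_finite ((Cc_compact hN a).image F.continuous).isBounded).image _
    refine h.subset ?_
    rintro ⟨a, b⟩ ⟨ha, x, hx, hFx⟩
    simp only [mem_iUnion]
    exact ⟨a, ha, b, ⟨F x, Sc_sub_Cc le_rfl _ hFx, x, Sc_sub_Cc le_rfl _ hx, rfl⟩, rfl⟩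
  exact this.to_subtype

theorem stepA {N : ℕ} (hN : 0 < N) (F : R2 ≃ₜ R2) :
    ∃ θ, 0 < θ ∧ θ ≤ 1 / 4 ∧ ∃ Ψ ∈ GG (Sc N 0), ∃ σ : BE N F → ℝ, Function.Injective σ ∧
      (∀ e, |σ e| < θ / 2) ∧ ∀ e, F (Ψ (Pt N e.1.1 0 (σ e))) ∈ Sc N θ e.1.2 := by
  have := BE_finite hN F
  have hp : ∀ e : BE N F, ∃ x ∈ Sc N 0 e.1.1, F x ∈ Sc N 0 e.1.2 := fun e => e.2.2
  choose p hp1 hp2 using hp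
  have hpi : InjL p := by
    intro e e' h
    obtain ⟨k, hk⟩ := lv_surj h
    have h1 : p e = p e' + lv k := by rw [← hk]; abel
    have h2 : p e ∈ Sc N 0 (sh N k e'.1.1) := by rw [h1]; exact Sc_sh.2 (hp1 e')
    have h3 := (Sc_good N le_rfl).disj _ _ _ h2 (hp1 e)
    obtain ⟨hk0, h4⟩ := Bs_unique e'.2.1 e.2.1 h3
    have h5 : p e = p e' := by
      rw [h1, hk0]; ext i; fin_cases i <;> simp [lv]
    have h6 : e.1.2 = e'.1.2 := (Sc_good N le_rfl).disj _ _ _ (hp2 e) (h5 ▸ hp2 e')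
    exact Subtype.ext (Prod.ext h4.symm h6)
  have hev : ∀ᶠ θ in 𝓝[>] (0 : ℝ), ∀ e, F (p e) ∈ Sc N θ e.1.2 := by
    refine eventually_all.2 fun e => ?_
    obtain ⟨q1, q2, q3, q4⟩ := hp2 e
    refine Filter.Eventually.filter_mono nhdsWithin_le_nhds ?_
    have hc : Continuous fun θ : ℝ => (e.1.2.2 : ℝ) + θ := by fun_prop
    have hc' : Continuous fun θ : ℝ => (e.1.2.2 : ℝ) + 1 - θ := by fun_prop
    filter_upwards [hc.continuousAt.eventually_lt continuousAt_const q3,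
      continuousAt_const.eventually_lt hc'.continuousAt q4] with θ a1 a2
    exact ⟨q1, q2, a1, a2⟩
  obtain ⟨θ, hθ, hθ2⟩ := (hev.and (Ioo_mem_nhdsGT (show (0 : ℝ) < 1 / 4 by norm_num))).exists
  obtain ⟨n, ⟨φ⟩⟩ := Finite.exists_equiv_fin (BE N F)
  let σ : BE N F → ℝ := fun e => θ / 2 * ((φ e : ℕ) / (n + 1))
  have hθ0 := hθ2.1
  have hσi : Function.Injective σ := by
    intro e e' h
    have h1 := mul_left_cancel₀ (by positivity) h
    have h2 : ((φ e : ℕ) : ℝ) = (φ e' : ℕ) := by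
      field_simp at h1; exact h1
    exact φ.injective (Fin.ext (by exact_mod_cast h2))
  have hσb : ∀ e, |σ e| < θ / 2 := by
    intro e
    rw [abs_of_nonneg (by simp only [σ]; positivity)]
    have : ((φ e : ℕ) : ℝ) < n := by exact_mod_cast (φ e).2
    have : ((φ e : ℕ) : ℝ) / (n + 1) < 1 := by rw [div_lt_one (by positivity)]; linarith
    simp only [σ]
    nlinarith
  obtain ⟨Ψ, hΨ, hΨ2⟩ := move_many (Sc_good N le_rfl) (fun e : BE N F => e.1.1)
    (fun e => Pt N e.1.1 0 (σ e)) p (fun e => Pt_mem hN _ (by norm_num) (by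
      have := hσb e; have := hθ2.2; linarith)) hp1
    (Pt_injL hN (fun e : BE N F => e.1.1) (fun _ => 0) σ hσi fun e => by
      have := hσb e; have := hθ2.2; linarith) hpi
  exact ⟨θ, hθ0, hθ2.2.le, Ψ, hΨ, σ, hσi, hσb, fun e => by rw [hΨ2 e]; exact hθ e⟩

theorem Pt_cont (N : ℕ) (a : Ix) : Continuous fun z : ℝ × ℝ => Pt N a z.1 z.2 := by
  unfold Pt; fun_prop

theorem stepB {N : ℕ} (hN : 0 < N) {κ : Type} [Finite κ] (a b : κ → Ix) {θ : ℝ} (hθ : 0 < θ)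
    (hθ1 : θ ≤ 1 / 4) (F : R2 ≃ₜ R2) (hF : Eqv F) (σ : κ → ℝ) (hσ : Function.Injective σ)
    (hσb : ∀ e, |σ e| < θ / 2) (hin : ∀ e, F (Pt N (a e) 0 (σ e)) ∈ Sc N θ (b e)) :
    ∃ Φ ∈ GG (Sc N θ), ∃ τ > 0, ∀ e, |σ e| + τ ≤ θ / 2 ∧
      (∀ t, |t - σ e| ≤ τ → Φ (F (Pt N (a e) 0 t)) ∈ Sc N θ (b e)) ∧
      N * Φ (F (Pt N (a e) 0 (σ e - τ))) 0 = (b e).1 + 1 / 8 ∧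
      N * Φ (F (Pt N (a e) 0 (σ e + τ))) 0 = (b e).1 + 7 / 8 := by
  have h1 : ∀ᶠ τ in 𝓝[>] (0 : ℝ), ∀ e, |σ e| + τ ≤ θ / 2 := by
    refine eventually_all.2 fun e => ?_
    filter_upwards [Ioo_mem_nhdsGT (sub_pos.2 (hσb e))] with τ hτ
    linarith [hτ.2]
  have h2 : ∀ᶠ τ in 𝓝[>] (0 : ℝ), ∀ e, ∀ t, |t - σ e| ≤ τ → F (Pt N (a e) 0 t) ∈ Sc N θ (b e) := by
    refine eventually_all.2 fun e => ?_
    have hc : Continuous fun t => F (Pt N (a e) 0 t) :=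
      F.continuous.comp ((Pt_cont N (a e)).comp (by fun_prop : Continuous fun t : ℝ => ((0 : ℝ), t)))
    have ho := ((Sc_good N hθ.le).opn (b e)).preimage hc
    obtain ⟨r, hr, hb⟩ := Metric.isOpen_iff.1 ho (σ e) (hin e)
    filter_upwards [Ioo_mem_nhdsGT hr] with τ hτ t ht
    exact hb (by rw [mem_ball, Real.dist_eq]; exact ht.trans_lt hτ.2)
  have h3 : ∀ᶠ τ in 𝓝[>] (0 : ℝ), ∀ e e', σ e - τ ≠ σ e' + τ := by
    refine eventually_all.2 fun e => eventually_all.2 fun e' => ?_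
    by_cases h : e = e'
    · subst h
      filter_upwards [self_mem_nhdsWithin] with τ hτ hcon
      have : (0 : ℝ) < τ := hτ
      linarith
    · refine Filter.Eventually.filter_mono nhdsWithin_le_nhds ?_
      have hc : ContinuousAt (fun τ : ℝ => σ e - τ - (σ e' + τ)) 0 :=
        Continuous.continuousAt (by fun_prop)
      have := hc.eventually_ne (y := 0) (by
        simp only [sub_zero, add_zero]; exact sub_ne_zero.2 fun h' => h (hσ h'))
      filter_upwards [this] with τ hτ
      exact sub_ne_zero.1 hτ
  obtain ⟨τ, ⟨⟨h1, h2⟩, h3⟩, hτ : 0 < τ⟩ := (((h1.and h2).and h3).and self_mem_nhdsWithin).exists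
  let u : κ × Bool → ℝ := fun i => if i.2 then σ i.1 + τ else σ i.1 - τ
  have hu : Function.Injective u := by
    rintro ⟨e, c⟩ ⟨e', c'⟩ h
    cases c <;> cases c' <;> simp only [u, if_true, if_false, Bool.false_eq_true] at h
    · rw [hσ (by linarith : σ e = σ e')]
    · exact absurd h (h3 e e')
    · exact absurd h.symm (h3 e' e)
    · rw [hσ (by linarith : σ e = σ e')]
  have hub : ∀ i, |u i| ≤ θ / 2 := by
    rintro ⟨e, c⟩
    have q1 := h1 e
    have q2 := le_abs_self (σ e)
    have q3 := neg_abs_le (σ e)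
    rw [abs_le]
    cases c <;> simp only [u, if_true, if_false, Bool.false_eq_true] <;> constructor <;> linarith
  have hud : ∀ i, |u i - σ i.1| ≤ τ := by
    rintro ⟨e, c⟩
    cases c <;> simp [u, abs_of_pos hτ]
  obtain ⟨Φ, hΦ, hm⟩ := move_many (Sc_good N hθ.le) (fun i : κ × Bool => b i.1)
    (fun i => F (Pt N (a i.1) 0 (u i)))
    (fun i => Pt N (b i.1) (if i.2 then 3 / 8 else -(3 / 8)) (u i))
    (fun i => h2 i.1 _ (hud i))
    (fun i => Pt_mem hN _ (by
      split_ifs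
      · rw [abs_lt]; constructor <;> norm_num
      · rw [abs_lt]; constructor <;> norm_num)
      (by have := hub i; linarith))
    (fun i i' h => Pt_injL hN (fun i : κ × Bool => a i.1) (fun _ => 0) u hu
      (fun i => by have := hub i; linarith) _ _ (Eqv.sub_mem hF h))
    (Pt_injL hN _ _ u hu (fun i => by have := hub i; linarith))
  refine ⟨Φ, hΦ, τ, hτ, fun e => ⟨h1 e, fun t ht => (hΦ.2.1 _ _).2 (h2 e t ht), ?_, ?_⟩⟩
  · have := hm (e, false)
    simp only [u, if_false, Bool.false_eq_true] at this
    rw [this, Pt0 hN]; ring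
  · have := hm (e, true)
    simp only [u, if_true] at this
    rw [this, Pt0 hN]; ring

theorem stepC {N : ℕ} {a b : Ix} {θ t1 t2 : ℝ} {G0 : R2 → R2} (hG : Continuous G0) (hθ : 0 ≤ θ)
    (h1 : ∀ t, t1 ≤ t → t ≤ t2 → G0 (Pt N a 0 t) ∈ Sc N θ b)
    (h2 : N * G0 (Pt N a 0 t1) 0 < b.1 + 1 / 4) (h3 : b.1 + 3 / 4 < N * G0 (Pt N a 0 t2) 0) :
    ∀ᶠ α in 𝓝[>] (0 : ℝ), ∀ s t, |s| ≤ 1 / 2 - θ → t1 ≤ t → t ≤ t2 →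
      G0 (Pt N a (-(α * s)) t) ∈ Sc N θ b ∧
      (t = t1 → N * G0 (Pt N a (-(α * s)) t) 0 < b.1 + 1 / 4) ∧
      (t = t2 → b.1 + 3 / 4 < N * G0 (Pt N a (-(α * s)) t) 0) := by
  have hc : Continuous fun z : ℝ × ℝ × ℝ => G0 (Pt N a (-(z.1 * z.2.1)) z.2.2) :=
    hG.comp ((Pt_cont N a).comp
      (by fun_prop : Continuous fun z : ℝ × ℝ × ℝ => (-(z.1 * z.2.1), z.2.2)))
  have tube : ∀ (K : Set (ℝ × ℝ)) (U : Set R2), IsCompact K → IsOpen U →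
      (∀ z ∈ K, G0 (Pt N a 0 z.2) ∈ U) →
      ∀ᶠ α in 𝓝[>] (0 : ℝ), ∀ z ∈ K, G0 (Pt N a (-(α * z.1)) z.2) ∈ U := by
    intro K U hK hU h
    refine Filter.Eventually.filter_mono nhdsWithin_le_nhds ?_
    refine hK.eventually_forall_of_forall_eventually fun z hz => ?_
    exact hc.continuousAt.eventually_mem (hU.mem_nhds (by simpa using h z hz))
  have A1 := tube (Icc (-(1 / 2 - θ)) (1 / 2 - θ) ×ˢ Icc t1 t2) (Sc N θ b)
    (isCompact_Icc.prod isCompact_Icc) ((Sc_good N hθ).opn b) (fun z hz => h1 _ hz.2.1 hz.2.2)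
  have A2 := tube (Icc (-(1 / 2 - θ)) (1 / 2 - θ) ×ˢ {t1}) {x | N * x 0 < b.1 + 1 / 4}
    (isCompact_Icc.prod isCompact_singleton) (isOpen_lt (by fun_prop) (by fun_prop))
    (fun z hz => by have : z.2 = t1 := hz.2
                    rw [this]; exact h2)
  have A3 := tube (Icc (-(1 / 2 - θ)) (1 / 2 - θ) ×ˢ {t2}) {x | b.1 + 3 / 4 < N * x 0}
    (isCompact_Icc.prod isCompact_singleton) (isOpen_lt (by fun_prop) (by fun_prop))
    (fun z hz => by have : z.2 = t2 := hz.2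
                    rw [this]; exact h3)
  filter_upwards [A1, A2, A3] with α B1 B2 B3 s t hs ht1 ht2
  exact ⟨B1 (s, t) ⟨abs_le.1 hs, ht1, ht2⟩, fun h => B2 (s, t) ⟨abs_le.1 hs, h⟩,
    fun h => B3 (s, t) ⟨abs_le.1 hs, h⟩⟩

def NeckE (N : ℕ) (θ η : ℝ) (a b : Ix) (G : R2 → R2) : Prop :=
  ∃ s1 s2 : ℝ, a.1 + 1 / 4 ≤ s1 ∧ s1 ≤ s2 ∧ s2 ≤ a.1 + 3 / 4 ∧
    ∀ p : R2, s1 ≤ N * p 0 → N * p 0 ≤ s2 → a.2 + θ ≤ N * p 1 → N * p 1 ≤ a.2 + 1 - θ →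
      ∀ u : R2, dist u (G p) < η →
      (b.2 + θ ≤ N * u 1 ∧ N * u 1 ≤ b.2 + 1 - θ) ∧
      (N * p 0 = s1 → N * u 0 ≤ b.1 + 1 / 4) ∧ (N * p 0 = s2 → b.1 + 3 / 4 ≤ N * u 0)

theorem stepD {N : ℕ} (hN : 0 < N) {a b : Ix} {θ s1 s2 : ℝ} {G : R2 → R2} (hG : Continuous G)
    (hθ : 0 ≤ θ) (hs1 : a.1 + 1 / 4 ≤ s1) (hs : s1 ≤ s2) (hs2 : s2 ≤ a.1 + 3 / 4)
    (h : ∀ p : R2, s1 ≤ N * p 0 → N * p 0 ≤ s2 → a.2 + θ ≤ N * p 1 → N * p 1 ≤ a.2 + 1 - θ →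
      G p ∈ Sc N θ b ∧ (N * p 0 = s1 → N * G p 0 < b.1 + 1 / 4) ∧
      (N * p 0 = s2 → b.1 + 3 / 4 < N * G p 0)) :
    ∀ᶠ η in 𝓝[>] (0 : ℝ), NeckE N θ η a b G := by
  let K : Set R2 := {p | s1 ≤ N * p 0 ∧ N * p 0 ≤ s2 ∧ a.2 + θ ≤ N * p 1 ∧ N * p 1 ≤ a.2 + 1 - θ}
  have hKc : IsClosed K := by
    refine IsClosed.and ?_ (IsClosed.and ?_ (IsClosed.and ?_ ?_)) <;>
      exact isClosed_le (by fun_prop) (by fun_prop)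
  have hK : IsCompact K := (Cc_compact hN a).of_isClosed_subset hKc (by
    rintro p ⟨q1, q2, q3, q4⟩
    refine ⟨?_, ?_, ?_, ?_⟩ <;> linarith)
  have thick : ∀ L U : Set R2, IsCompact L → IsOpen U → (∀ p ∈ L, G p ∈ U) →
      ∀ᶠ η in 𝓝[>] (0 : ℝ), ∀ p ∈ L, ∀ u, dist u (G p) < η → u ∈ U := by
    intro L U hL hU hLU
    obtain ⟨δ, hδ, hsub⟩ := (hL.image hG).exists_thickening_subset_open hU (by
      rintro _ ⟨p, hp, rfl⟩; exact hLU p hp)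
    filter_upwards [Ioo_mem_nhdsGT hδ] with η hη p hp u hu
    exact hsub (mem_thickening_iff.2 ⟨G p, ⟨p, hp, rfl⟩, hu.trans hη.2⟩)
  have cl1 : IsClosed {p : R2 | N * p 0 = s1} := isClosed_eq (by fun_prop) (by fun_prop)
  have cl2 : IsClosed {p : R2 | N * p 0 = s2} := isClosed_eq (by fun_prop) (by fun_prop)
  have A1 := thick K (Sc N θ b) hK ((Sc_good N hθ).opn b)
    (fun p hp => (h p hp.1 hp.2.1 hp.2.2.1 hp.2.2.2).1)
  have A2 := thick (K ∩ {p | N * p 0 = s1}) {x | N * x 0 < b.1 + 1 / 4} (hK.inter_right cl1)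
    (isOpen_lt (by fun_prop) (by fun_prop))
    (fun p hp => (h p hp.1.1 hp.1.2.1 hp.1.2.2.1 hp.1.2.2.2).2.1 hp.2)
  have A3 := thick (K ∩ {p | N * p 0 = s2}) {x | b.1 + 3 / 4 < N * x 0} (hK.inter_right cl2)
    (isOpen_lt (by fun_prop) (by fun_prop))
    (fun p hp => (h p hp.1.1 hp.1.2.1 hp.1.2.2.1 hp.1.2.2.2).2.2 hp.2)
  filter_upwards [A1, A2, A3] with η B1 B2 B3
  refine ⟨s1, s2, hs1, hs, hs2, fun p q1 q2 q3 q4 u hu => ?_⟩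
  have hp : p ∈ K := ⟨q1, q2, q3, q4⟩
  have c1 := B1 p hp u hu
  exact ⟨⟨c1.2.2.1.le, c1.2.2.2.le⟩, fun h => le_of_lt (B2 p ⟨hp, h⟩ u hu),
    fun h => le_of_lt (B3 p ⟨hp, h⟩ u hu)⟩


theorem stepE {N : ℕ} (hN : 0 < N) {G : R2 → R2} (hG : Continuous G) {a : Ix} {Q : Ix → Prop}
    (h : ∀ b x, x ∈ Cc N a → G x ∈ Cc N b → Q b) :
    ∀ᶠ η in 𝓝[>] (0 : ℝ), ∀ b x u, x ∈ Cc N a → dist u (G x) < η → u ∈ Cc N b → Q b := by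
  have hK : IsCompact (G '' Cc N a) := (Cc_compact hN a).image hG
  have hfin : {b | (Cc N b ∩ thickening 1 (G '' Cc N a)).Nonempty}.Finite :=
    Cc_finite hK.isBounded.thickening
  have hev : ∀ᶠ η in 𝓝[>] (0 : ℝ), ∀ b ∈ {b | (Cc N b ∩ thickening 1 (G '' Cc N a)).Nonempty},
      ∀ x u, x ∈ Cc N a → dist u (G x) < η → u ∈ Cc N b → Q b := by
    refine (eventually_all_finite hfin).2 fun b _ => ?_
    by_cases hb : Q b
    · exact Eventually.of_forall fun _ _ _ _ _ _ => hb
    · obtain ⟨δ, hδ, hsub⟩ := hK.exists_thickening_subset_open (Cc_closed N b).isOpen_compl (by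
        rintro _ ⟨x, hx, rfl⟩ hcon
        exact hb (h b x hx hcon))
      filter_upwards [Ioo_mem_nhdsGT hδ] with η hη x u hx hu hub
      exact absurd hub (hsub (mem_thickening_iff.2 ⟨G x, ⟨x, hx, rfl⟩, hu.trans hη.2⟩))
  filter_upwards [hev, Ioo_mem_nhdsGT (show (0 : ℝ) < 1 by norm_num)] with η h1 h2 b x u hx hu hub
  exact h1 b ⟨u, hub, mem_thickening_iff.2 ⟨G x, ⟨x, hx, rfl⟩, hu.trans h2.2⟩⟩ x u hx hu hub

theorem Edg_sh {N : ℕ} {F : R2 → R2} (hF : Eqv F) {a b k : Ix} (h : Edg N F a b) :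
    Edg N F (sh N k a) (sh N k b) := by
  obtain ⟨x, hx, hy⟩ := h
  refine ⟨x + lv k, Sc_sh.2 hx, ?_⟩
  rw [hF _ _ (lv_mem k)]
  exact Sc_sh.2 hy

theorem sh_inv (N : ℕ) (k a : Ix) : sh N k (sh N (-k) a) = a := by
  rw [sh_add, add_neg_cancel, sh_zero]

theorem sh_inv' (N : ℕ) (k a : Ix) : sh N (-k) (sh N k a) = a := by
  rw [sh_add, neg_add_cancel, sh_zero]

theorem lv_neg (k : Ix) : lv (-k) = -lv k := by
  ext i; fin_cases i <;> simp [lv]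

theorem neck_of_base {N : ℕ} (hN : 0 < N) {θ η : ℝ} {F : R2 → R2} (hF : Eqv F) {G G' : R2 → R2}
    (hG' : Eqv G') (hcl : ∀ x, dist (G' x) (G x) < η)
    (h : ∀ e : BE N F, NeckE N θ η e.1.1 e.1.2 G) : NeckProp N θ (Edg N F) G' := by
  intro a b hab
  obtain ⟨k, a0, ha0, rfl⟩ := Bs_repr hN a
  have hE : Edg N F a0 (sh N (-k) b) := by
    have := Edg_sh (k := -k) hF hab
    rwa [sh_inv'] at this
  obtain ⟨s1, s2, h1, h2, h3, h4⟩ := h ⟨(a0, sh N (-k) b), ha0, hE⟩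
  simp only at h1 h2 h3 h4
  refine ⟨s1 + N * k.1, s2 + N * k.1, ?_, ?_, ?_, ?_⟩
  · simp only [sh]; push_cast; linarith
  · linarith
  · simp only [sh]; push_cast; linarith
  · intro p p1 p2 p3 p4
    have e0 : N * (p + lv (-k)) 0 = N * p 0 - N * k.1 := by simp [lv]; ring
    have e1 : N * (p + lv (-k)) 1 = N * p 1 - N * k.2 := by simp [lv]; ring
    have hg : G' (p + lv (-k)) = G' p + lv (-k) := hG' _ _ (lv_mem _)
    have f0 : N * (G' p + lv (-k)) 0 = N * G' p 0 - N * k.1 := by simp [lv]; ring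
    have f1 : N * (G' p + lv (-k)) 1 = N * G' p 1 - N * k.2 := by simp [lv]; ring
    simp only [sh] at p3 p4
    push_cast at p3 p4
    have := h4 (p + lv (-k)) (by rw [e0]; linarith) (by rw [e0]; linarith) (by rw [e1]; linarith)
      (by rw [e1]; linarith) (G' (p + lv (-k))) (hcl _)
    rw [hg, f0, f1, e0] at this
    simp only [sh] at this
    push_cast at this
    simp only [Prod.fst_neg, Prod.snd_neg, Int.cast_neg] at this
    obtain ⟨⟨c1, c2⟩, c3, c4⟩ := this
    refine ⟨⟨by linarith, by linarith⟩, fun hh => ?_, fun hh => ?_⟩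
    · have := c3 (by linarith); linarith
    · have := c4 (by linarith); linarith

theorem construct (F : R2 ≃ₜ R2) (hF : Eqv F) {N : ℕ} (hN : 0 < N) {ε : ℝ} (hε : 0 < ε) :
    ∃ v : R2, ‖v‖ < ε ∧ ∃ Φ ∈ GG (Sc N 0), ∃ Ψ ∈ GG (Sc N 0), ∃ η > 0, ∀ G' G'' : R2 ≃ₜ R2,
      Eqv G' → Eqv G'' → (∀ x, dist (G' x) (Φ (F (Ψ x) + v)) < η) →
      (∀ x, dist (G'' x) (Φ (F (Ψ x) + v)) < η) → rotSet G' ⊆ rotSet G'' := by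
  obtain ⟨v, hv, hbaire⟩ := baire_shift F hN hε
  let F1 : R2 ≃ₜ R2 := F.trans (Homeomorph.addRight v)
  have hF1 : ∀ x, F1 x = F x + v := fun x => rfl
  have hF1e : Eqv F1 := by
    intro x w hw
    rw [hF1, hF1, hF _ _ hw]; abel
  have := BE_finite hN F1
  obtain ⟨θ, hθ, hθ1, Ψ, hΨ, σ, hσ, hσb, hin⟩ := stepA hN F1
  let F2 : R2 ≃ₜ R2 := Ψ.trans F1
  have hF2e : Eqv F2 := by
    intro x w hw
    change F1 (Ψ (x + w)) = F1 (Ψ x) + w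
    rw [hΨ.1.1 _ _ hw, hF1e _ _ hw]
  obtain ⟨Φ, hΦ, τ, hτ, hB⟩ := stepB hN (fun e : BE N F1 => e.1.1) (fun e => e.1.2) hθ hθ1 F2 hF2e σ hσ
    hσb hin
  let G0 : R2 ≃ₜ R2 := F2.trans Φ
  have hC : ∀ᶠ α in 𝓝[>] (0 : ℝ), ∀ e : BE N F1, _ := eventually_all.2 fun e : BE N F1 =>
    stepC (N := N) (a := e.1.1) (b := e.1.2) (t1 := σ e - τ) (t2 := σ e + τ) G0.continuous hθ.le
      (fun t ht1 ht2 => (hB e).2.1 t (by rw [abs_le]; constructor <;> linarith))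
      (by have := (hB e).2.2.1
          change N * Φ (F2 _) 0 < _
          rw [this]; linarith)
      (by have := (hB e).2.2.2
          change _ < N * Φ (F2 _) 0
          rw [this]; linarith)
  obtain ⟨α, hα, hα0, hα1⟩ := (hC.and (Ioo_mem_nhdsGT (show (0 : ℝ) < 1 by norm_num))).exists
  obtain ⟨Λ, hΛ, hΛ2⟩ := lam_exists hN hα0 hα1.le hθ (by linarith : θ ≤ 1 / 2)
  let G : R2 ≃ₜ R2 := Λ.trans G0
  have hΦ0 : Φ ∈ GG (Sc N 0) := GG_mono (Sc_sub hθ.le) (Sc_good N le_rfl).disj hΦ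
  have hG : ∀ x, G x = Φ (F ((Ψ * Λ) x) + v) := fun x => rfl
  have hG2 : ∀ x, G x = Φ (F1 (Ψ (Λ x))) := fun x => rfl
  have hG3 : ∀ x, G x = G0 (Λ x) := fun x => rfl
  have hneck : ∀ᶠ η in 𝓝[>] (0 : ℝ), ∀ e : BE N F1, NeckE N θ η e.1.1 e.1.2 G := by
    refine eventually_all.2 fun e => ?_
    have b1 := (hB e).1
    have b2 := le_abs_self (σ e)
    have b3 := neg_abs_le (σ e)
    refine stepD hN (s1 := e.1.1.1 + 1 / 2 + α * (σ e - τ)) (s2 := e.1.1.1 + 1 / 2 + α * (σ e + τ))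
      G.continuous hθ.le (by nlinarith) (by nlinarith) (by nlinarith) ?_
    intro p p1 p2 p3 p4
    set s := N * p 0 - e.1.1.1 - 1 / 2 with hs
    set t := N * p 1 - e.1.1.2 - 1 / 2 with ht
    have hp : p = Pt N e.1.1 s t := Pt_eq hN _ p
    have hs1 : |s| ≤ α * (θ / 2) := by
      rw [abs_le]; constructor <;> nlinarith
    have ht1 : |t| ≤ 1 / 2 - θ := by
      rw [abs_le]; constructor <;> linarith
    have hGp : G p = G0 (Pt N e.1.1 (-(α * t)) (s / α)) := by
      rw [hG3, ← hΛ2 _ _ _ hs1 ht1, ← hp]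
    have := hα e t (s / α) ht1 (by rw [le_div_iff₀ hα0]; linarith) (by rw [div_le_iff₀ hα0]; linarith)
    rw [← hGp] at this
    refine ⟨this.1, fun hh => this.2.1 ?_, fun hh => this.2.2 ?_⟩
    · rw [div_eq_iff hα0.ne']; linarith
    · rw [div_eq_iff hα0.ne']; linarith
  have hA : ∀ᶠ η in 𝓝[>] (0 : ℝ), ∀ a ∈ Bs N, ∀ b x u, x ∈ Cc N a → dist u (G x) < η → u ∈ Cc N b →
      Edg N F1 a b := by
    refine (eventually_all_finite (Bs_finite N)).2 fun a _ => stepE hN G.continuous ?_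
    intro b x hx hGx
    rw [hG2, GG_Cc le_rfl hΦ0] at hGx
    refine hbaire a b ⟨Ψ (Λ x), ?_, hGx⟩
    rw [GG_Cc le_rfl hΨ, GG_Cc le_rfl hΛ]; exact hx
  obtain ⟨η, ⟨hn, hA⟩, hη⟩ := ((hneck.and hA).and self_mem_nhdsWithin).exists
  refine ⟨v, hv, Φ, hΦ0, Ψ * Λ, mul_mem hΨ hΛ, η, hη, ?_⟩
  intro G' G'' hG' hG'' hc' hc''
  refine rot_incl hN hθ.le (by linarith : θ ≤ 1 / 2) (E := Edg N F1) ?_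
    (neck_of_base hN hF1e hG'' (G := G) hc'' hn)
  intro a b x hx hGx
  obtain ⟨k, a0, ha0, rfl⟩ := Bs_repr hN a
  have hx' : x + lv (-k) ∈ Cc N a0 := by
    rw [← sh_inv' N k a0]; exact Cc_sh.2 hx
  have hGx' : G' (x + lv (-k)) ∈ Cc N (sh N (-k) b) := by
    rw [hG' _ _ (lv_mem _)]; exact Cc_sh.2 hGx
  have := hA a0 ha0 _ _ _ hx' (hc' _) hGx'
  have := Edg_sh (k := k) hF1e this
  rwa [sh_inv] at this


theorem pr_surj : Function.Surjective pr := QuotientAddGroup.mk_surjective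

theorem pr_cont : Continuous pr := continuous_quotient_mk'

theorem pr_quot : IsQuotientMap pr := isQuotientMap_quotient_mk'

theorem pr_eq {x y : R2} : pr x = pr y ↔ x - y ∈ intLattice := by
  unfold pr
  rw [QuotientAddGroup.eq, ← neg_mem_iff]
  rw [neg_add, neg_neg, sub_eq_add_neg]

theorem pr_dist_lt {x y : R2} {r : ℝ} :
    dist (pr x) (pr y) < r ↔ ∃ w ∈ intLattice, ‖x - y - w‖ < r := by
  have : dist (pr x) (pr y) = ‖(QuotientAddGroup.mk (x - y) : T2)‖ := by
    rw [dist_eq_norm]; rfl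
  rw [this, QuotientAddGroup.norm_lt_iff]
  constructor
  · rintro ⟨m, hm, hr⟩
    have h2 : (x - y) - m ∈ intLattice := pr_eq.1 hm.symm
    exact ⟨_, h2, by simpa using hr⟩
  · rintro ⟨w, hw, hr⟩
    refine ⟨x - y - w, ?_, hr⟩
    exact pr_eq.2 (by simpa using hw)

theorem pr_dist_le (x y : R2) : dist (pr x) (pr y) ≤ dist x y := by
  refine le_of_forall_gt fun r hr => ?_
  exact pr_dist_lt.2 ⟨0, zero_mem _, by rw [sub_zero, ← dist_eq_norm]; exact hr⟩

instance : CompactSpace T2 := by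
  have : pr '' (Cc 1 (0, 0)) = univ := by
    refine eq_univ_of_forall fun q => ?_
    obtain ⟨x, rfl⟩ := pr_surj q
    refine ⟨frc x, ?_, pr_eq.2 ?_⟩
    · have h0 := frc_mem x 0
      have h1 := frc_mem x 1
      refine ⟨?_, ?_, ?_, ?_⟩ <;> simp
      · exact h0.1
      · exact h0.2.le
      · exact h1.1
      · exact h1.2.le
    · have := frc_add_flr x
      have h2 : frc x - x = -flr x := by
        nth_rewrite 2 [← this]; abel
      rw [h2]; exact neg_mem (flr_mem x)
  exact ⟨this ▸ (Cc_compact one_pos _).image pr_cont⟩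

def indF (Φ : R2 → R2) (q : T2) : T2 := pr (Φ (Function.surjInv pr_surj q))

theorem indF_pr {Φ : R2 → R2} (h : Eqv Φ) (x : R2) : indF Φ (pr x) = pr (Φ x) := by
  have h1 : pr (Function.surjInv pr_surj (pr x)) = pr x := Function.surjInv_eq pr_surj _
  have h2 := pr_eq.1 h1
  unfold indF
  rw [pr_eq]
  have h3 := h x _ h2
  rw [add_sub_cancel] at h3
  rw [h3]; simpa using h2

theorem indF_cont {Φ : R2 → R2} (h : Eqv Φ) (hc : Continuous Φ) : Continuous (indF Φ) := by
  rw [pr_quot.continuous_iff]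
  have : indF Φ ∘ pr = pr ∘ Φ := funext fun x => indF_pr h x
  rw [this]
  exact pr_cont.comp hc

theorem ind_exists (Φ : R2 ≃ₜ R2) (h : Eqv Φ) : ∃ f : T2 ≃ₜ T2, IsLift f Φ := by
  let f : T2 ≃ₜ T2 :=
    { toFun := indF Φ
      invFun := indF Φ.symm
      left_inv := fun q => by
        obtain ⟨x, rfl⟩ := pr_surj q
        rw [indF_pr h, indF_pr h.symm, Homeomorph.symm_apply_apply]
      right_inv := fun q => by
        obtain ⟨x, rfl⟩ := pr_surj q
        rw [indF_pr h.symm, indF_pr h, Homeomorph.apply_symm_apply]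
      continuous_toFun := indF_cont h Φ.continuous
      continuous_invFun := indF_cont h.symm Φ.symm.continuous }
  exact ⟨f, fun x => (indF_pr h x).symm, h⟩

theorem lift_mp {f : T2 ≃ₜ T2} {Φ : R2 ≃ₜ R2} (hΦ : Φ ∈ PP) (hf : IsLift f Φ) :
    MeasurePreserving f lebT2 lebT2 := by
  have mf : Measurable f := f.continuous.measurable
  have mp : Measurable pr := pr_cont.measurable
  refine ⟨mf, ?_⟩
  ext E hE
  have key : ∀ E : Set T2, MeasurableSet E → lebT2 E = volume (pr ⁻¹' E ∩ fundDomain) := by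
    intro E hE
    rw [lebT2, Measure.map_apply mp hE, Measure.restrict_apply (mp hE)]
  rw [Measure.map_apply mf hE, key _ (mf hE), key _ hE]
  have hD : IsAddFundamentalDomain intLattice (Φ '' fundDomain) volume := by
    refine IsAddFundamentalDomain.mk' ?_ ?_
    · exact (Φ.measurableEmbedding.measurableSet_image.2 measurable_fund).nullMeasurableSet
    · intro x
      have e : ∀ w : intLattice, w +ᵥ x ∈ Φ '' fundDomain ↔ Φ.symm x + w ∈ fundDomain := by
        intro w
        have e1 : (w +ᵥ x : R2) = x + w := add_comm _ _
        rw [e1, ← hΦ.1.symm _ _ w.2]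
        constructor
        · rintro ⟨y, hy, hh⟩
          rw [← hh, Homeomorph.symm_apply_apply]; exact hy
        · intro hh
          exact ⟨_, hh, Homeomorph.apply_symm_apply _ _⟩
      refine ⟨⟨-flr (Φ.symm x), neg_mem (flr_mem _)⟩, ?_, ?_⟩
      · simp only [e]
        have h1 := frc_add_flr (Φ.symm x)
        have : Φ.symm x + -flr (Φ.symm x) = frc (Φ.symm x) := by
          nth_rewrite 1 [← h1]; abel
        rw [this]; exact frc_mem _
      · intro w hw
        have hw' := (e w).1 hw
        have := flr_add (Φ.symm x) w w.2
        rw [flr_of_mem hw'] at this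
        apply Subtype.ext
        exact (neg_eq_of_add_eq_zero_right this.symm).symm
  have hset : pr ⁻¹' (f ⁻¹' E) ∩ fundDomain = Φ ⁻¹' (pr ⁻¹' E ∩ Φ '' fundDomain) := by
    ext x
    simp only [mem_inter_iff, mem_preimage, hf.proj, Φ.injective.mem_set_image]
  rw [hset, hΦ.2.measure_preimage ((mp hE).inter
    (Φ.measurableEmbedding.measurableSet_image.2 measurable_fund)).nullMeasurableSet]
  refine hD.measure_set_eq fund_isFD (mp hE) ?_
  intro w
  ext x
  simp only [mem_preimage]
  have : pr (w +ᵥ x : R2) = pr x := pr_eq.2 (by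
    have e1 : (w +ᵥ x : R2) = w + x := rfl
    rw [e1]; simp)
  rw [this]

theorem sup_bdd {G G' : R2 ≃ₜ R2} (h : Eqv G) (h' : Eqv G') :
    BddAbove (range fun x : R2 => dist (G x) (G' x)) := by
  have hc : Continuous fun x : R2 => dist (G x) (G' x) := G.continuous.dist G'.continuous
  obtain ⟨M, hM⟩ := ((Cc_compact one_pos (0, 0)).image hc).bddAbove
  refine ⟨M, ?_⟩
  rintro _ ⟨x, rfl⟩
  have e : x = frc x + flr x := (frc_add_flr x).symm
  have h0 := frc_mem x 0
  have h1 := frc_mem x 1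
  have : dist (G x) (G' x) = dist (G (frc x)) (G' (frc x)) := by
    nth_rewrite 1 2 [e]
    rw [h _ _ (flr_mem x), h' _ _ (flr_mem x), dist_add_right]
  simp only [this]
  refine hM ⟨frc x, ?_, rfl⟩
  refine ⟨?_, ?_, ?_, ?_⟩ <;> simp
  · exact h0.1
  · exact h0.2.le
  · exact h1.1
  · exact h1.2.le

theorem le_sup {G G' : R2 ≃ₜ R2} (h : Eqv G) (h' : Eqv G') (x : R2) :
    dist (G x) (G' x) ≤ supDist G G' := le_ciSup (sup_bdd h h') x

theorem le_dC0 (f g : T2 ≃ₜ T2) (x : T2) : dist (f x) (g x) ≤ dC0 f g :=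
  le_ciSup (isCompact_range (f.continuous.dist g.continuous)).bddAbove x

theorem lat_sep {w w' : R2} (hw : w ∈ intLattice) (hw' : w' ∈ intLattice) (h : dist w w' < 1) :
    w = w' := by
  ext i
  obtain ⟨m, hm⟩ := hw i
  obtain ⟨n, hn⟩ := hw' i
  have := (coord_le_dist w w' i).trans_lt h
  rw [hm, hn] at this ⊢
  have h2 : |m - n| < 1 := by
    have h3 : ((|m - n| : ℤ) : ℝ) < 1 := by push_cast; exact this
    exact_mod_cast h3
  rw [Int.abs_lt_one_iff] at h2
  rw [sub_eq_zero.1 h2]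

theorem lift_close {f g : T2 ≃ₜ T2} {F G : R2 ≃ₜ R2} (hF : IsLift f F) (hG : IsLift g G) {r : ℝ}
    (hr : r ≤ 1 / 4) (h : dC0 f g < r) :
    ∃ w ∈ intLattice, ∀ x, dist (F x) (G x + w) < r := by
  have hx : ∀ x, ∃ w ∈ intLattice, F x - G x ∈ ball w r := by
    intro x
    have h1 := (le_dC0 f g (pr x)).trans_lt h
    rw [← hF.proj, ← hG.proj, pr_dist_lt] at h1
    obtain ⟨w, hw, hlt⟩ := h1
    exact ⟨w, hw, by rw [mem_ball, dist_eq_norm]; exact hlt⟩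
  obtain ⟨w0, hw0, h0⟩ := hx 0
  refine ⟨w0, hw0, ?_⟩
  have hc : Continuous fun x => F x - G x := F.continuous.sub G.continuous
  have hpre : IsPreconnected (range fun x => F x - G x) := isPreconnected_range hc
  have hsub := hpre.subset_left_of_subset_union (u := ball w0 r)
    (v := ⋃ w ∈ {w : R2 | w ∈ intLattice ∧ w ≠ w0}, ball w r) isOpen_ball
    (isOpen_biUnion fun _ _ => isOpen_ball) (by
      rw [Set.disjoint_left]
      intro u hu hu2
      simp only [mem_iUnion] at hu2
      obtain ⟨w, ⟨hw, hne⟩, huw⟩ := hu2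
      apply hne
      apply lat_sep hw hw0
      rw [mem_ball] at hu huw
      have := dist_triangle w u w0
      rw [dist_comm w u] at this
      linarith) (by
      rintro _ ⟨x, rfl⟩
      obtain ⟨w, hw, hxw⟩ := hx x
      by_cases hww : w = w0
      · left; rw [← hww]; exact hxw
      · right
        simp only [mem_iUnion]
        exact ⟨w, ⟨hw, hww⟩, hxw⟩) ⟨F 0 - G 0, mem_range_self (f := fun x => F x - G x) 0, h0⟩
  intro x
  have := hsub (mem_range_self x)
  rw [mem_ball, dist_eq_norm] at this
  rw [dist_eq_norm]
  have e : F x - (G x + w0) = F x - G x - w0 := by abel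
  rw [e]; exact this

theorem open_part : OpenIn Homeo0Leb {f | HasStableRotSet Homeo0Leb f} := by
  rintro f ⟨⟨F, hF, δ, hδ, hst⟩, hfH⟩
  refine ⟨min (δ / 2) (1 / 4), by positivity, fun g hg hfg => ?_⟩
  obtain ⟨⟨G, hG⟩, hgm⟩ := id hg
  obtain ⟨w, hw, hcl⟩ := lift_close hF hG (min_le_right _ _) hfg
  let G' : R2 ≃ₜ R2 := G.trans (Homeomorph.addRight w)
  have hG'x : ∀ x, G' x = G x + w := fun x => rfl
  have hG' : IsLift g G' := by
    refine ⟨fun x => ?_, fun x u hu => ?_⟩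
    · rw [← hG.proj, hG'x, pr_eq]; simpa using hw
    · rw [hG'x, hG'x, hG.equivariant _ _ hu]; abel
  have hd : ∀ x, dist (F x) (G' x) ≤ δ / 2 := fun x => (hcl x).le.trans (min_le_left _ _)
  have e1 : rotSet G' = rotSet F := by
    refine hst g hg G' hG' ?_
    have : supDist F G' ≤ δ / 2 := ciSup_le hd
    linarith
  refine ⟨G', hG', δ / 2, by positivity, ?_⟩
  intro g2 hg2 G2 hG2 hs
  rw [e1]
  refine hst g2 hg2 G2 hG2 ?_
  have : supDist F G2 ≤ δ / 2 + supDist G' G2 := ciSup_le fun x =>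
    (dist_triangle _ (G' x) _).trans (add_le_add (hd x) (le_sup hG'.equivariant hG2.equivariant x))
  linarith

theorem dense_part : DenseIn Homeo0Leb {f | HasStableRotSet Homeo0Leb f} := by
  rintro f ⟨⟨F, hF⟩, hfm⟩ ε hε
  have huc := CompactSpace.uniformContinuous_of_continuous f.continuous
  obtain ⟨δ, hδ, huc⟩ := Metric.uniformContinuous_iff.1 huc (ε / 4) (by positivity)
  obtain ⟨N, hN⟩ := exists_nat_gt (2 / min δ (ε / 4))
  have hm : 0 < min δ (ε / 4) := by positivity
  have hN0 : (0 : ℝ) < N := lt_trans (by positivity) hN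
  have hN1 : 0 < N := by exact_mod_cast hN0
  have hNs : 2 / N < min δ (ε / 4) := by
    rw [div_lt_iff₀ hN0]; rw [div_lt_iff₀ hm] at hN; linarith
  obtain ⟨v, hv, Φ, hΦ, Ψ, hΨ, η, hη, hst⟩ :=
    construct F hF.equivariant hN1 (show 0 < ε / 4 by positivity)
  obtain ⟨φ, hφ⟩ := ind_exists Φ hΦ.1.1
  obtain ⟨ψ, hψ⟩ := ind_exists Ψ hΨ.1.1
  obtain ⟨t, ht⟩ := ind_exists (Homeomorph.addRight v) (PP_trans v).1
  let g : T2 ≃ₜ T2 := ψ.trans (f.trans (t.trans φ))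
  let G : R2 ≃ₜ R2 := Ψ.trans (F.trans ((Homeomorph.addRight v).trans Φ))
  have hgx : ∀ x, g x = φ (t (f (ψ x))) := fun x => rfl
  have hGx : ∀ x, G x = Φ (F (Ψ x) + v) := fun x => rfl
  have hG : IsLift g G := by
    refine ⟨fun x => ?_, fun x w hw => ?_⟩
    · rw [hgx, hGx, hφ.proj, ← hψ.proj, ← hF.proj, ← ht.proj]; rfl
    · rw [hGx, hGx, hΨ.1.1 _ _ hw, hF.equivariant _ _ hw, ← hΦ.1.1 _ _ hw]
      congr 1; abel
  have hgH : g ∈ Homeo0Leb := ⟨⟨G, hG⟩,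
    (lift_mp hΦ.1 hφ).comp ((lift_mp (PP_trans v) ht).comp (hfm.comp (lift_mp hΨ.1 hψ)))⟩
  refine ⟨g, ⟨⟨G, hG, η, hη, ?_⟩, hgH⟩, ?_⟩
  · intro g' hg' G' hG' hs
    have hc : ∀ x, dist (G' x) (Φ (F (Ψ x) + v)) < η := fun x => by
      rw [← hGx, dist_comm]
      exact (le_sup hG.equivariant hG'.equivariant x).trans_lt hs
    have hc2 : ∀ x, dist (G x) (Φ (F (Ψ x) + v)) < η := fun x => by
      rw [← hGx, dist_self]; exact hη
    exact Subset.antisymm (hst _ _ hG'.equivariant hG.equivariant hc hc2)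
      (hst _ _ hG.equivariant hG'.equivariant hc2 hc)
  · have hb : ∀ (χ : T2 ≃ₜ T2) (X : R2 ≃ₜ R2), X ∈ GG (Sc N 0) → IsLift χ X → ∀ q,
        dist (χ q) q ≤ 2 / N := by
      intro χ X hX hl q
      obtain ⟨x, rfl⟩ := pr_surj q
      rw [← hl.proj]
      exact (pr_dist_le _ _).trans (GG_dist hN1 le_rfl hX x)
    have hle : dC0 f g ≤ 3 * (ε / 4) := by
      refine ciSup_le fun q => ?_
      have d1 : dist (f q) (f (ψ q)) < ε / 4 := by
        apply huc
        rw [dist_comm]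
        exact (hb ψ Ψ hΨ hψ q).trans_lt (hNs.trans_le (min_le_left _ _))
      have d2 : dist (f (ψ q)) (t (f (ψ q))) ≤ ε / 4 := by
        obtain ⟨x, hx⟩ := pr_surj (f (ψ q))
        rw [← hx, ← ht.proj]
        refine (pr_dist_le _ _).trans ?_
        simpa using hv.le
      have d3 : dist (t (f (ψ q))) (g q) ≤ ε / 4 := by
        rw [hgx, dist_comm]
        exact (hb φ Φ hΦ hφ _).trans (hNs.le.trans (min_le_right _ _))
      have := dist_triangle4 (f q) (f (ψ q)) (t (f (ψ q))) (g q)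
      linarith
    linarith


/-- The set of homeomorphisms `f ∈ Homeo_{0,λ}(T²)` whose rotation set is
stable under `C⁰`-small perturbations within `Homeo_{0,λ}(T²)` is open and dense in
`Homeo_{0,λ}(T²)` for the uniform `C⁰` topology. -/
theorem stable_rotation_set_open_and_dense_in_Homeo0Leb :
    OpenIn Homeo0Leb {f | HasStableRotSet Homeo0Leb f} ∧
    DenseIn Homeo0Leb {f | HasStableRotSet Homeo0Leb f} := by
  exact ⟨open_part, dense_part⟩
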